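/- arXiv:2407.03464 — 4 statements merged into one kernel-verified Lean document; each statement's English description precedes it below -/
import Mathlib

section
/- For every integer N ≥ 1 and every δ ∈ (0, 1/2) there exist constants C > 0 and τ₀ ∈ (0,1) such that for all τ ∈ (0, τ₀), all ε ∈ (0, π), and all z ∈ ℂ with |Im z| ≤ 1/2 − δ: |∫_ℝ e^{−2i(t+iε)z} / (4(t+iε) sinh(τ(t+iε)) sinh(t+iε)) dt − Σ_{n=0}^{N} ((1 − 2^{2n−1}) B_{2n}/(2n)!) (πi)^{2n−1} τ^{2n−1} Li_{2−2n}(−e^{2πz})| ≤ C·τ^{2N+1} (the shift by iε realizes the contour ℝ + i0 passing above the origin). -/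
open MeasureTheory

noncomputable section

/-- The dilogarithm `Li₂(z) = -∫₀¹ Log(1 - t z) dt / t` (principal branch of `Log`). -/
def Li2 (z : ℂ) : ℂ := -∫ t in (0:ℝ)..1, Complex.log (1 - (t:ℂ) * z) / (t:ℂ)

/-- Negative-index polylogarithms: `LiNeg m = Li_{-m}`, with `Li₀(w) = w/(1-w)` and
`Li_{-m}(w) = w ⬝ d/dw Li_{-m+1}(w)`. -/
def LiNeg : ℕ → ℂ → ℂ
  | 0 => fun w => w / (1 - w)
  | (m+1) => fun w => w * deriv (LiNeg m) w

/-- `LiIdx n = Li_{2-2n}`: the dilogarithm for `n = 0`, and `Li_{-(2n-2)}` for `n ≥ 1`. -/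
def LiIdx (n : ℕ) : ℂ → ℂ := if n = 0 then Li2 else LiNeg (2*n - 2)

/-- `L_b(z) = i ∫₀^∞ ( sin(2yz)/(2 sinh(y/b) sinh(by)) - z/y ) dy/y`. -/
def Lb (b : ℝ) (z : ℂ) : ℂ :=
  Complex.I * ∫ y in Set.Ioi (0:ℝ),
    (Complex.sin (2 * (y:ℂ) * z) / (2 * (Real.sinh (y / b) : ℂ) * (Real.sinh (b * y) : ℂ))
      - z / (y:ℂ)) / (y:ℂ)

/-- Ruijsenaars' hyperbolic gamma function `s_b(z) = exp(L_b(z))`. -/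
def sb (b : ℝ) (z : ℂ) : ℂ := Complex.exp (Lb b z)

/-- `Q = b + b⁻¹` as a complex number. -/
def Qb (b : ℝ) : ℂ := (b:ℂ) + (b:ℂ)⁻¹

/-- The function `𝓜(b, ζ', ω')`, the contour being the horizontal line `Im = -Q/4`. -/
def Mfun (b : ℝ) (ζ : ℝ) (ω : ℂ) : ℂ :=
  sb b ζ * ∫ x : ℝ,
    Complex.exp (Complex.I * (Real.pi:ℂ) * ((x:ℂ) - Complex.I * Qb b / 4)
        * ((ζ:ℂ) - Complex.I * Qb b / 2 + 2 * ω)) *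
      sb b ((x:ℂ) - Complex.I * Qb b / 4 - (ζ:ℂ))
        / sb b ((x:ℂ) - Complex.I * Qb b / 4 + Complex.I * Qb b / 2)

/-- The exponent `f_𝓜(ζ, ω)`. -/
def fM (ζ : ℝ) (ω : ℂ) : ℂ :=
  -(Li2 (-Complex.exp (2 * (Real.pi:ℂ) * (ζ:ℂ)))
    + Li2 (-(Complex.exp (-((Real.pi:ℂ) * (ζ:ℂ))) * Complex.cosh ((Real.pi:ℂ) * ω)
        / Complex.sinh ((Real.pi:ℂ) * ((ζ:ℂ) + ω))))
    - Li2 (Complex.exp ((Real.pi:ℂ) * (ζ:ℂ)) * Complex.cosh ((Real.pi:ℂ) * ω)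
        / Complex.sinh ((Real.pi:ℂ) * ((ζ:ℂ) + ω))))
    / (2 * (Real.pi:ℂ) * Complex.I)
  + Complex.I * (Real.pi:ℂ) * (ζ:ℂ)^2
  + Complex.I * (ω - Complex.I / 2) *
      Complex.log (Complex.exp ((Real.pi:ℂ) * (ζ:ℂ)) * Complex.cosh ((Real.pi:ℂ) * ω)
        / Complex.sinh ((Real.pi:ℂ) * ((ζ:ℂ) + ω)))
  + Complex.I * (Real.pi:ℂ) / 6

/-- The function `𝓠(b, σ', μ')`, the contour being the horizontal line `Im = -3Q/8`. -/
def Qfun (b : ℝ) (σ μ : ℝ) : ℂ :=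
  Complex.exp (Complex.I * (Real.pi:ℂ) *
      (1/6 + 7 * (Qb b)^2 / 24 - (μ:ℂ)^2/2 + Complex.I * (μ:ℂ) * Qb b - (σ:ℂ)^2)) * sb b μ *
  ∫ x : ℝ,
    Complex.exp (-(Complex.I * (Real.pi:ℂ) * ((x:ℂ) - 3 * Complex.I * Qb b / 8)^2)) *
    Complex.exp (2 * Complex.I * (Real.pi:ℂ) * ((x:ℂ) - 3 * Complex.I * Qb b / 8)
      * ((μ:ℂ) - Complex.I * Qb b / 2)) *
    sb b ((x:ℂ) - 3 * Complex.I * Qb b / 8 + (σ:ℂ)) *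
    sb b ((x:ℂ) - 3 * Complex.I * Qb b / 8 - (σ:ℂ))

/-- The exponent `f_𝓠(σ, μ)`. -/
def fQ (σ μ : ℝ) : ℂ :=
  -(Li2 (-Complex.exp (2 * (Real.pi:ℂ) * (μ:ℂ)))) / (2 * (Real.pi:ℂ) * Complex.I)
  - Li2 (Complex.exp (-(2 * (Real.pi:ℂ) * (σ:ℂ))) *
      ((Real.cosh (2*Real.pi*σ) : ℂ) + Complex.I *
        (Real.sqrt (Real.exp (2*Real.pi*μ) - Real.sinh (2*Real.pi*σ)^2) : ℂ)))
    / (2 * (Real.pi:ℂ) * Complex.I)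
  - Li2 (Complex.exp (2 * (Real.pi:ℂ) * (σ:ℂ)) *
      ((Real.cosh (2*Real.pi*σ) : ℂ) + Complex.I *
        (Real.sqrt (Real.exp (2*Real.pi*μ) - Real.sinh (2*Real.pi*σ)^2) : ℂ)))
    / (2 * (Real.pi:ℂ) * Complex.I)
  + (1/2 + Complex.I * (μ:ℂ)) *
      Complex.log (-(Real.cosh (2*Real.pi*σ) : ℂ) - Complex.I *
        (Real.sqrt (Real.exp (2*Real.pi*μ) - Real.sinh (2*Real.pi*σ)^2) : ℂ))
  - (Real.pi:ℂ) * (μ:ℂ) + 5 * (Real.pi:ℂ) * Complex.I / 12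

/-- The phase function `f(t)` of the saddle point analysis of `𝓜`. -/
def fMt (ζ : ℝ) (ω t : ℂ) : ℂ :=
  -(Li2 (-Complex.exp (2*(Real.pi:ℂ)*(ζ:ℂ)))
    + Li2 (-Complex.exp (2*(Real.pi:ℂ)*(t-(ζ:ℂ))))
    - Li2 (-Complex.exp (2*(Real.pi:ℂ)*(t+Complex.I/2)))) / (2*(Real.pi:ℂ)*Complex.I)
  + Complex.I*(Real.pi:ℂ)*(ζ:ℂ)^2 + 2*Complex.I*(Real.pi:ℂ)*t*ω + (Real.pi:ℂ)*t
  + Complex.I*(Real.pi:ℂ)/6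

/-- The amplitude `g(t)` of the saddle point analysis of `𝓜`. -/
def gM (t : ℂ) : ℂ :=
  Complex.exp ((Real.pi:ℂ)*t - Complex.log (1 - Complex.exp (2*(Real.pi:ℂ)*t)) / 2)

/-- The error term `E(τ, t)` from the semiclassical analysis of `𝓜`. -/
def Efun (ζ τ : ℝ) (t : ℂ) : ℂ :=
  Complex.I * (Li2 (Complex.exp (2*(Real.pi:ℂ)*t))
      - Li2 (Complex.exp (Complex.I*(Real.pi:ℂ)*(τ:ℂ) + 2*(Real.pi:ℂ)*t))) / (2*(Real.pi:ℂ)*(τ:ℂ))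
  + Complex.log (1 - Complex.exp (2*(Real.pi:ℂ)*t)) / 2
  + (Complex.I*(Real.pi:ℂ)*(τ:ℂ)/12) *
      (Complex.exp (2*(Real.pi:ℂ)*t + Complex.I*(Real.pi:ℂ)*(τ:ℂ))
          / (Complex.exp (2*(Real.pi:ℂ)*t + Complex.I*(Real.pi:ℂ)*(τ:ℂ)) - 1)
        - Complex.exp (2*(Real.pi:ℂ)*(ζ:ℂ)) / (Complex.exp (2*(Real.pi:ℂ)*(ζ:ℂ)) + 1)
        - Complex.exp (2*(Real.pi:ℂ)*t)
          / (Complex.exp (2*(Real.pi:ℂ)*(ζ:ℂ)) + Complex.exp (2*(Real.pi:ℂ)*t)) + 2)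

/-- The phase function `f(t)` of the saddle point analysis of `𝓠`. -/
def fQt (σ μ : ℝ) (t : ℂ) : ℂ :=
  -(Li2 (-Complex.exp (2*(Real.pi:ℂ)*(μ:ℂ)))
    + Li2 (-Complex.exp (2*(Real.pi:ℂ)*(t-(σ:ℂ))))
    + Li2 (-Complex.exp (2*(Real.pi:ℂ)*(t+(σ:ℂ))))) / (2*(Real.pi:ℂ)*Complex.I)
  + 2*Complex.I*(Real.pi:ℂ)*(μ:ℂ)*t + (Real.pi:ℂ)*(t-(μ:ℂ)) + 5*Complex.I*(Real.pi:ℂ)/12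

/-- The amplitude `g(t)` of the saddle point analysis of `𝓠`. -/
def gQ (μ : ℝ) (t : ℂ) : ℂ := Complex.exp ((Real.pi:ℂ)*(t-(μ:ℂ)))

end


section
open MeasureTheory

lemma dse_norm_sinh_sq (t s : ℝ) :
    ‖Complex.sinh ((t:ℂ) + Complex.I * (s:ℂ))‖^2 = Real.sinh t ^2 + Real.sin s ^2 := by
  have h : Complex.sinh ((t:ℂ) + Complex.I * (s:ℂ))
      = ((Real.sinh t * Real.cos s : ℝ) : ℂ) + ((Real.cosh t * Real.sin s : ℝ) : ℂ) * Complex.I := by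
    rw [mul_comm, Complex.sinh_add, Complex.sinh_mul_I, Complex.cosh_mul_I]
    push_cast; ring
  rw [h, ← Complex.normSq_eq_norm_sq, Complex.normSq_add_mul_I]
  have h1 := Real.cosh_sq t
  have h2 := Real.sin_sq_add_cos_sq s
  have : Real.cos s ^2 = 1 - Real.sin s^2 := by linarith
  rw [mul_pow, mul_pow, h1, this]; ring

lemma dse_sinh_le (t s : ℝ) :
    |Real.sinh t| ≤ ‖Complex.sinh ((t:ℂ) + Complex.I * (s:ℂ))‖ := by
  refine abs_le_of_sq_le_sq ?_ (norm_nonneg _)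
  rw [dse_norm_sinh_sq]; nlinarith [sq_nonneg (Real.sin s)]

lemma dse_cosh_le (t s : ℝ) :
    |Real.sin s| * Real.cosh t ≤ ‖Complex.sinh ((t:ℂ) + Complex.I * (s:ℂ))‖ := by
  apply le_of_sq_le_sq _ (norm_nonneg _)
  rw [dse_norm_sinh_sq, mul_pow, sq_abs, Real.cosh_sq]
  nlinarith [sq_nonneg (Real.sinh t), Real.sin_sq_le_one s, mul_nonneg (sq_nonneg (Real.sinh t)) (sub_nonneg.2 (Real.sin_sq_le_one s))]

lemma dse_half_exp_le_cosh (t : ℝ) : Real.exp |t| / 2 ≤ Real.cosh t := by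
  rw [← Real.cosh_abs, Real.cosh_eq]
  have := Real.exp_pos (-|t|)
  linarith

lemma dse_abs_sinh (t : ℝ) : |t| * Real.exp |t| ≤ (1 + 2 * |t|) * |Real.sinh t| := by
  have h : |Real.sinh t| = Real.sinh |t| := by
    rw [Real.abs_sinh]
  rw [h]
  set x := |t|
  have hx : 0 ≤ x := abs_nonneg t
  rw [Real.sinh_eq]
  have h1 : 1 + 2 * x ≤ Real.exp (2*x) := by have := Real.add_one_le_exp (2*x); linarith
  have h2 : Real.exp (2*x) = Real.exp x * Real.exp x := by rw [← Real.exp_add]; ring_nf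
  have h3 : Real.exp x * Real.exp (-x) = 1 := by rw [← Real.exp_add]; simp
  have h4 := Real.exp_pos (-x)
  have h5 := Real.exp_pos x
  have : (1+2*x) * Real.exp (-x) ≤ Real.exp x := by
    calc (1+2*x) * Real.exp (-x) ≤ Real.exp (2*x) * Real.exp (-x) := by gcongr
      _ = Real.exp x := by rw [← Real.exp_add]; ring_nf
  linarith

lemma dse_integrable_exp {a : ℝ} (ha : 0 < a) :
    Integrable (fun t : ℝ => Real.exp (-(a * |t|))) := by
  have h1 : IntegrableOn (fun t : ℝ => Real.exp (-(a * |t|))) (Set.Ioi 0) := by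
    refine (exp_neg_integrableOn_Ioi 0 ha).congr_fun (fun t ht => ?_) measurableSet_Ioi
    simp only [abs_of_pos (Set.mem_Ioi.1 ht), neg_mul]
  have h2 : IntegrableOn (fun t : ℝ => Real.exp (-(a * |t|))) (Set.Iic 0) := by
    rw [integrableOn_Iic_iff_integrableOn_Iio]
    simpa using h1.comp_neg
  rw [← integrableOn_univ, ← Set.Iic_union_Ioi (a := (0:ℝ))]
  exact h2.union h1

lemma dse_norm_exp (t e : ℝ) (z : ℂ) :
    ‖Complex.exp (-(2*Complex.I*((t:ℂ)+Complex.I*(e:ℂ))*z))‖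
      = Real.exp (2 * (t * z.im + e * z.re)) := by
  rw [Complex.norm_exp]; congr 1
  simp; ring

lemma dse_pow_le {η : ℝ} (hη : 0 < η) (n : ℕ) {x : ℝ} (hx : 0 ≤ x) :
    x^n ≤ n.factorial / η^n * Real.exp (η * x) := by
  have := Real.pow_div_factorial_le_exp (η*x) (by positivity) n
  rw [div_le_iff₀ (by positivity), mul_pow] at this
  rw [div_mul_eq_mul_div, le_div_iff₀ (by positivity)]
  linarith
  
/-- decay on a strip -/
def dseDec (a b : ℝ) (f : ℂ → ℂ) : Prop := ∃ C c : ℝ, 0 < c ∧ ∀ t s : ℝ, 1 ≤ |t| → s ∈ Set.Icc a b →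
  ‖f ((t:ℂ) + Complex.I * (s:ℂ))‖ ≤ C * Real.exp (-(c * |t|))

lemma dseDec.mono {a b a' b' : ℝ} {f : ℂ → ℂ} (h : dseDec a b f) (ha : a ≤ a') (hb : b' ≤ b) :
    dseDec a' b' f := by
  obtain ⟨C, c, hc, h⟩ := h
  exact ⟨C, c, hc, fun t s ht hs => h t s ht ⟨ha.trans hs.1, hs.2.trans hb⟩⟩

lemma dseDec.add {a b : ℝ} {f g : ℂ → ℂ} (hf : dseDec a b f) (hg : dseDec a b g) :
    dseDec a b (fun u => f u + g u) := by
  obtain ⟨C, c, hc, hf⟩ := hf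
  obtain ⟨D, d, hd, hg⟩ := hg
  refine ⟨|C| + |D|, min c d, lt_min hc hd, fun t s ht hs => ?_⟩
  have h1 := hf t s ht hs
  have h2 := hg t s ht hs
  have e1 : Real.exp (-(c*|t|)) ≤ Real.exp (-(min c d*|t|)) := by
    gcongr; exact min_le_left _ _
  have e2 : Real.exp (-(d*|t|)) ≤ Real.exp (-(min c d*|t|)) := by
    gcongr; exact min_le_right _ _
  calc _ ≤ C * Real.exp (-(c * |t|)) + D * Real.exp (-(d * |t|)) := (norm_add_le _ _).trans (add_le_add h1 h2)
    _ ≤ |C| * Real.exp (-(c * |t|)) + |D| * Real.exp (-(d * |t|)) := by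
      gcongr <;> exact le_abs_self _
    _ ≤ |C| * Real.exp (-(min c d*|t|)) + |D| * Real.exp (-(min c d*|t|)) := by gcongr
    _ = _ := by ring

lemma dseDec.const_mul {a b : ℝ} {f : ℂ → ℂ} (hf : dseDec a b f) (k : ℂ) :
    dseDec a b (fun u => k * f u) := by
  obtain ⟨C, c, hc, hf⟩ := hf
  refine ⟨‖k‖ * C, c, hc, fun t s ht hs => ?_⟩
  rw [norm_mul, mul_assoc]
  exact mul_le_mul_of_nonneg_left (hf t s ht hs) (norm_nonneg _)

lemma dseDec.sum {a b : ℝ} {f : ℕ → ℂ → ℂ} (hf : ∀ n, dseDec a b (f n)) (N : ℕ) :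
    dseDec a b (fun u => ∑ n ∈ Finset.range N, f n u) := by
  induction N with
  | zero => exact ⟨0, 1, one_pos, by simp⟩
  | succ N ih => simpa only [Finset.sum_range_succ] using ih.add (hf N)

lemma dse_line_integrable {a b : ℝ} {f : ℂ → ℂ} (hf : dseDec a b f) {s : ℝ} (hs : s ∈ Set.Icc a b)
    (hc : Continuous (fun t : ℝ => f ((t:ℂ) + Complex.I * (s:ℂ)))) :
    Integrable (fun t : ℝ => f ((t:ℂ) + Complex.I * (s:ℂ))) := by
  obtain ⟨C, c, hc0, hf⟩ := hf
  refine hc.locallyIntegrable.integrable_of_isBigO_cocompact (g := fun t : ℝ => Real.exp (-(c * |t|))) ?_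
    ((dse_integrable_exp hc0).integrableAtFilter _)
  refine Asymptotics.IsBigO.of_bound C ?_
  have : ∀ᶠ t : ℝ in Filter.cocompact ℝ, 1 ≤ ‖t‖ := (tendsto_norm_cocompact_atTop (E := ℝ)).eventually_ge_atTop 1
  filter_upwards [this] with t ht
  rw [Real.norm_of_nonneg (Real.exp_pos _).le]
  exact hf t s ht hs

lemma dse_shift {a b : ℝ} (hab : a ≤ b) {f : ℂ → ℂ} (hf : dseDec a b f)
    (hc : ContinuousOn f {u | u.im ∈ Set.Icc a b})
    (hd : DifferentiableOn ℂ f {u | u.im ∈ Set.Ioo a b}) :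
    (∫ t : ℝ, f ((t:ℂ) + Complex.I * (a:ℂ))) = ∫ t : ℝ, f ((t:ℂ) + Complex.I * (b:ℂ)) := by
  have hline : ∀ s ∈ Set.Icc a b, Continuous (fun t : ℝ => f ((t:ℂ) + Complex.I * (s:ℂ))) := by
    intro s hs
    refine hc.comp_continuous (by fun_prop) (fun t => ?_)
    simpa using hs
  have ia := dse_line_integrable hf (Set.left_mem_Icc.2 hab) (hline a (Set.left_mem_Icc.2 hab))
  have ib := dse_line_integrable hf (Set.right_mem_Icc.2 hab) (hline b (Set.right_mem_Icc.2 hab))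
  have rect : ∀ T : ℝ, (∫ x : ℝ in -T..T, f ((x:ℂ) + Complex.I * (a:ℂ)))
      - (∫ x : ℝ in -T..T, f ((x:ℂ) + Complex.I * (b:ℂ)))
      = Complex.I * (∫ y : ℝ in a..b, f (((-T:ℝ):ℂ) + Complex.I * (y:ℂ)))
        - Complex.I * (∫ y : ℝ in a..b, f ((T:ℂ) + Complex.I * (y:ℂ))) := by
    intro T
    have := Complex.integral_boundary_rect_eq_zero_of_continuousOn_of_differentiableOn f
      (⟨-T, a⟩ : ℂ) (⟨T, b⟩ : ℂ) (hc.mono ?_) (hd.mono ?_)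
    · simp only [smul_eq_mul, mul_comm _ Complex.I] at this
      linear_combination this
    · intro u hu
      have := hu.2
      simpa [Set.uIcc_of_le hab] using this
    · intro u hu
      have := hu.2
      simpa [hab] using this
  obtain ⟨C, c, hc0, hf⟩ := hf
  have hexp : Filter.Tendsto (fun T : ℝ => C * Real.exp (-(c * |T|)) * |b - a|) Filter.atTop (nhds 0) := by
    have : Filter.Tendsto (fun T : ℝ => Real.exp (-(c * |T|))) Filter.atTop (nhds 0) := by
      refine Real.tendsto_exp_neg_atTop_nhds_zero.comp ?_
      exact Filter.tendsto_abs_atTop_atTop.const_mul_atTop hc0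
    simpa using (this.const_mul C).mul_const |b - a|
  have side : ∀ T : ℝ, 1 ≤ |T| → ‖∫ y : ℝ in a..b, f ((T:ℂ) + Complex.I * (y:ℂ))‖ ≤ C * Real.exp (-(c * |T|)) * |b - a| := by
    intro T hT
    refine intervalIntegral.norm_integral_le_of_norm_le_const (fun y hy => hf T y hT ?_)
    rw [Set.uIoc_of_le hab] at hy
    exact ⟨hy.1.le, hy.2⟩
  have s1 : Filter.Tendsto (fun T : ℝ => ∫ y : ℝ in a..b, f ((T:ℂ) + Complex.I * (y:ℂ))) Filter.atTop (nhds 0) := by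
    refine squeeze_zero_norm' ?_ hexp
    filter_upwards [Filter.eventually_ge_atTop 1] with T hT
    exact side T (hT.trans (le_abs_self T))
  have s2 : Filter.Tendsto (fun T : ℝ => ∫ y : ℝ in a..b, f (((-T:ℝ):ℂ) + Complex.I * (y:ℂ))) Filter.atTop (nhds 0) := by
    refine squeeze_zero_norm' ?_ hexp
    filter_upwards [Filter.eventually_ge_atTop 1] with T hT
    have := side (-T) (by rw [abs_neg]; exact hT.trans (le_abs_self T))
    rwa [abs_neg] at this
  have l1 := (intervalIntegral_tendsto_integral ia Filter.tendsto_neg_atTop_atBot Filter.tendsto_id).sub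
    (intervalIntegral_tendsto_integral ib Filter.tendsto_neg_atTop_atBot Filter.tendsto_id)
  have l2 := (s2.const_mul Complex.I).sub (s1.const_mul Complex.I)
  have := tendsto_nhds_unique l1 (l2.congr (fun T => (rect T).symm))
  simp at this
  exact sub_eq_zero.1 this

end


section
open MeasureTheory

lemma dse_sech (z : ℂ) (hz : |z.im| < 1/2) :
    ∫ t : ℝ, Complex.exp (-(2*Complex.I*(t:ℂ)*z)) / Complex.cosh (t:ℂ)
      = (Real.pi:ℂ) / Complex.cosh ((Real.pi:ℂ) * z) := by
  rw [abs_lt] at hz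
  set s : ℂ := 1/2 - Complex.I * z with hs
  have hsre : s.re = 1/2 + z.im := by simp [hs]
  have h0 : 0 < s.re := by rw [hsre]; linarith
  have h1 : 0 < (1 - s).re := by simp only [Complex.sub_re, Complex.one_re, hsre]; linarith
  have hb := Complex.Gamma_mul_Gamma_eq_betaIntegral h0 h1
  rw [Complex.Gamma_mul_Gamma_one_sub, add_sub_cancel, Complex.Gamma_one, one_mul] at hb
  have hsin : Complex.sin ((Real.pi:ℂ) * s) = Complex.cosh ((Real.pi:ℂ) * z) := by
    rw [hs, ← Complex.cos_mul_I, ← Complex.sin_pi_div_two_sub]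
    congr 1; ring
  rw [hsin] at hb
  rw [hb, Complex.betaIntegral, intervalIntegral.integral_of_le zero_le_one, integral_Ioc_eq_integral_Ioo]
  set φ : ℝ → ℝ := fun t => (1 + Real.exp (-(2*t)))⁻¹ with hφ
  have hpos : ∀ t, 0 < φ t := fun t => by simp only [hφ]; positivity
  have hder : ∀ t, HasDerivAt φ (2 * Real.exp (-(2*t)) * (φ t)^2) t := by
    intro t
    have e : HasDerivAt (fun t : ℝ => 1 + Real.exp (-(2*t))) (Real.exp (-(2*t)) * (-(2*1))) t :=
      (((hasDerivAt_id t).const_mul 2).neg.exp).const_add 1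
    have := e.inv (by positivity)
    refine HasDerivAt.congr_deriv (f := φ) this ?_
    simp only [hφ]; field_simp
  have h1φ : ∀ t, 1 - φ t = Real.exp (-(2*t)) * φ t := by
    intro t; simp only [hφ]; field_simp; ring
  have hinj : Set.InjOn φ Set.univ := by
    intro a _ b _ hab
    simp only [hφ, inv_inj, add_right_inj, Real.exp_eq_exp] at hab
    linarith
  have himg : φ '' Set.univ = Set.Ioo 0 1 := by
    ext x; constructor
    · rintro ⟨t, -, rfl⟩
      refine ⟨hpos t, ?_⟩
      have := h1φ t
      have : 0 < 1 - φ t := by rw [this]; exact mul_pos (Real.exp_pos _) (hpos t)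
      linarith
    · rintro ⟨hx0, hx1⟩
      refine ⟨-(Real.log (1/x - 1))/2, trivial, ?_⟩
      have : 0 < 1/x - 1 := by rw [sub_pos, lt_div_iff₀ hx0]; linarith
      simp only [hφ]
      rw [show -(2 * (-(Real.log (1/x - 1))/2)) = Real.log (1/x - 1) by ring, Real.exp_log this]
      simp
  rw [← himg, integral_image_eq_integral_abs_deriv_smul MeasurableSet.univ
    (fun t _ => (hder t).hasDerivWithinAt) hinj, Measure.restrict_univ]
  congr 1; ext t
  have hp := hpos t
  have hc : (φ t : ℂ) ≠ 0 := by exact_mod_cast hp.ne'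
  have hc1 : (1 - (φ t:ℂ)) ≠ 0 := by
    have := h1φ t
    have h2 : 0 < 1 - φ t := by rw [this]; exact mul_pos (Real.exp_pos _) (hpos t)
    exact_mod_cast h2.ne'
  have hl : Complex.log (1 - (φ t:ℂ)) = -(2*t) + Complex.log (φ t) := by
    have : (1 - (φ t:ℂ)) = ((1 - φ t : ℝ) : ℂ) := by push_cast; rfl
    rw [this, h1φ, ← Complex.ofReal_log (mul_pos (Real.exp_pos _) hp).le,
      Real.log_mul (Real.exp_pos _).ne' hp.ne', Real.log_exp, ← Complex.ofReal_log hp.le]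
    push_cast; rfl
  rw [abs_of_pos (by positivity), Complex.cpow_def_of_ne_zero hc, Complex.cpow_def_of_ne_zero hc1,
    ← Complex.exp_add, hl,
    show Complex.log (φ t) * (s - 1) + (-(2*(t:ℂ)) + Complex.log (φ t)) * (1 - s - 1)
      = -Complex.log (φ t) + (t + (-(2 * Complex.I * t * z))) by rw [hs]; ring, Complex.exp_add, Complex.exp_neg (Complex.log _),
      Complex.exp_log hc, Complex.exp_add (t:ℂ), Complex.real_smul]
  have hφc : (φ t : ℂ) = (1 + Complex.exp (-(2*t)))⁻¹ := by simp only [hφ]; push_cast; rfl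
  have hne : (1 + Complex.exp (-(2*(t:ℂ)))) ≠ 0 := by
    intro h; rw [h] at hφc; simp at hφc; exact hc (by rw [hφc]; simp)
  have e2 : Complex.exp (-(2*(t:ℂ))) = (Complex.exp t)⁻¹ * (Complex.exp t)⁻¹ := by
    rw [← Complex.exp_neg, ← Complex.exp_add]; ring_nf
  have hch : Complex.cosh t = Complex.exp t * (1 + Complex.exp (-(2*t))) / 2 := by
    rw [Complex.cosh, e2, Complex.exp_neg]
    have := Complex.exp_ne_zero t
    field_simp
  push_cast
  rw [hch, hφc]
  have := Complex.exp_ne_zero (t:ℂ)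
  rw [e2] at hne ⊢
  field_simp

end


section
open MeasureTheory Asymptotics Filter Topology

lemma dse_bern_poly (M : ℕ) : ∃ q : Polynomial ℂ, ∀ x : ℂ,
    x - (∑ k ∈ Finset.range M, ((bernoulli k : ℚ) : ℂ) / (k.factorial : ℂ) * x^k) *
      ((∑ k ∈ Finset.range (M+1), x^k / (k.factorial:ℂ)) - 1) = x^(M+1) * q.eval x := by
  have key : (Polynomial.X : Polynomial ℂ)^(M+1) ∣ Polynomial.X -
     (bernoulliPowerSeries ℂ).trunc M * ((PowerSeries.exp ℂ).trunc (M+1) - 1) := by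
    rw [Polynomial.X_pow_dvd_iff]
    intro d hd
    have hB := congrArg (PowerSeries.coeff d) (bernoulliPowerSeries_mul_exp_sub_one ℂ)
    rw [PowerSeries.coeff_mul, PowerSeries.coeff_X] at hB
    rw [Polynomial.coeff_sub, Polynomial.coeff_mul, Polynomial.coeff_X, sub_eq_zero, eq_comm]
    have e1 : (if 1 = d then (1:ℂ) else 0) = if d = 1 then 1 else 0 := by simp [eq_comm]
    rw [e1, ← hB]
    refine Finset.sum_congr rfl (fun p hp => ?_)
    rw [Finset.HasAntidiagonal.mem_antidiagonal] at hp
    rw [Polynomial.coeff_sub, PowerSeries.coeff_trunc, PowerSeries.coeff_trunc, map_sub,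
      if_pos (show p.2 < M+1 by omega), Polynomial.coeff_one, PowerSeries.coeff_one]
    by_cases h2 : p.2 = 0
    · simp [h2]
    · rw [if_pos (show p.1 < M by omega)]
  obtain ⟨q, hq⟩ := key
  refine ⟨q, fun x => ?_⟩
  have := congrArg (Polynomial.eval x) hq
  simp only [Polynomial.eval_sub, Polynomial.eval_mul, Polynomial.eval_X, Polynomial.eval_pow, Polynomial.eval_one] at this
  rw [← this]
  congr 2
  · rw [Polynomial.eval, PowerSeries.eval₂_trunc_eq_sum_range]
    simp [bernoulliPowerSeries]
  · rw [Polynomial.eval, PowerSeries.eval₂_trunc_eq_sum_range]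
    congr 1
    simp [PowerSeries.exp, div_eq_inv_mul]

lemma dse_bern_isBigO (M : ℕ) : 
    (fun x : ℂ => x / (Complex.exp x - 1) - ∑ k ∈ Finset.range M, ((bernoulli k : ℚ) : ℂ) / (k.factorial : ℂ) * x^k)
      =O[𝓝[≠] 0] (fun x => x^M) := by
  obtain ⟨q, hq⟩ := dse_bern_poly M
  set P : ℂ → ℂ := fun x => ∑ k ∈ Finset.range M, ((bernoulli k : ℚ) : ℂ) / (k.factorial : ℂ) * x^k with hP
  have hPc : Continuous P := by simp only [hP]; fun_prop
  have h1 : (fun x : ℂ => x - P x * (Complex.exp x - 1)) =O[𝓝 0] (fun x => x^(M+1)) := by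
    have e := Complex.exp_sub_sum_range_isBigO_pow (M+1)
    have e1 : (fun x : ℂ => P x * (Complex.exp x - ∑ k ∈ Finset.range (M+1), x^k / (k.factorial:ℂ))) =O[𝓝 0] (fun x => x^(M+1)) := by
      simpa using ((hPc.continuousAt (x := 0)).isBigO_one ℂ).mul e
    have e2 : (fun x : ℂ => x^(M+1) * q.eval x) =O[𝓝 0] (fun x => x^(M+1)) := by
      simpa using (isBigO_refl (fun x : ℂ => x^(M+1)) (𝓝 0)).mul ((q.continuous.continuousAt (x := 0)).isBigO_one ℂ)
    refine (e2.sub e1).congr_left (fun x => ?_)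
    rw [← hq x]; simp only [hP]; ring
  have h3 : ∀ᶠ x : ℂ in 𝓝[≠] 0, Complex.exp x - 1 ≠ 0 := by
    have ht := hasDerivAt_iff_tendsto_slope.1 (Complex.hasDerivAt_exp 0)
    have hne : ∀ᶠ x : ℂ in 𝓝[≠] 0, slope Complex.exp 0 x ≠ 0 := ht.eventually_ne (by simp)
    filter_upwards [hne] with x hx h
    simp [slope_def_field, h] at hx
  have h2 : (fun x : ℂ => x) =O[𝓝[≠] 0] (fun x => Complex.exp x - 1) := by
    have := (Complex.hasDerivAt_exp 0)
    have ht := hasDerivAt_iff_tendsto_slope.1 this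
    have : Tendsto (fun x : ℂ => x / (Complex.exp x - 1)) (𝓝[≠] 0) (𝓝 1) := by
      have := ht.inv₀ (by simp)
      simp only [Complex.exp_zero, inv_one] at this
      refine this.congr (fun x => ?_)
      simp [slope_def_field]
    refine isBigO_of_div_tendsto_nhds ?_ 1 this
    filter_upwards [h3] with x hx h
    exact absurd h hx
  have h1' := h1.mono (nhdsWithin_le_nhds (s := {0}ᶜ))
  have h5 : (fun x : ℂ => (Complex.exp x - 1)⁻¹) =O[𝓝[≠] 0] (fun x => x⁻¹) := by
    refine h2.inv_rev ?_
    filter_upwards [self_mem_nhdsWithin] with x hx h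
    exact absurd h hx
  refine (h1'.mul h5).congr' ?_ ?_
  · filter_upwards [h3] with x hx
    change _ = x / (Complex.exp x - 1) - P x
    field_simp
  · filter_upwards [self_mem_nhdsWithin] with x hx
    have : x ≠ 0 := hx
    rw [pow_succ]; field_simp

/-- the expansion coefficients -/
noncomputable def dseC (n : ℕ) : ℂ := (1 - (2:ℂ)^(2*(n:ℤ)-1)) * ((bernoulli (2*n) : ℚ) : ℂ)
                  / (Nat.factorial (2*n) : ℂ)

/-- remainder of the expansion of the reciprocal of sinh -/
noncomputable def dseR (N : ℕ) (x : ℂ) : ℂ :=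
  (Complex.sinh x)⁻¹ - ∑ n ∈ Finset.range (N+1), 2 * dseC n * x^(2*(n:ℤ)-1)

lemma dse_sum_even (N : ℕ) (x : ℂ) :
    ∑ k ∈ Finset.range (2*(N+1)), (2 - (2:ℂ)^k) * (((bernoulli k : ℚ) : ℂ) / (k.factorial : ℂ)) * x^k
      = ∑ n ∈ Finset.range (N+1), 2 * dseC n * x^(2*n) := by
  have hc : ∀ n : ℕ, (2 - (2:ℂ)^(2*n)) * (((bernoulli (2*n) : ℚ) : ℂ) / ((2*n).factorial : ℂ)) = 2 * dseC n := by
    intro n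
    have : (2:ℂ)^(2*n) = 2 * (2:ℂ)^(2*(n:ℤ)-1) := by
      rw [zpow_sub_one₀ two_ne_zero]
      have : (2:ℂ)^(2*(n:ℤ)) = (2:ℂ)^(2*n) := by exact_mod_cast zpow_natCast (2:ℂ) (2*n)
      rw [this]; field_simp
    rw [this, dseC]; ring
  have hodd : ∀ n : ℕ, (2 - (2:ℂ)^(2*n+1)) * (((bernoulli (2*n+1) : ℚ) : ℂ) / ((2*n+1).factorial : ℂ)) = 0 := by
    intro n
    rcases Nat.eq_zero_or_pos n with rfl | hn
    · simp
    · rw [bernoulli_eq_zero_of_odd ⟨n, rfl⟩ (by omega)]; simp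
  generalize N + 1 = K
  induction K with
  | zero => simp
  | succ K ih =>
    rw [show 2*(K+1) = 2*K+1+1 by ring, Finset.sum_range_succ, Finset.sum_range_succ, ih,
      Finset.sum_range_succ, hc, hodd]; ring

lemma dse_R_isBigO (N : ℕ) : dseR N =O[𝓝[≠] 0] (fun x => x^(2*N+1)) := by
  have h1 := dse_bern_isBigO (2*(N+1))
  have ht : Tendsto (fun x : ℂ => 2 * x) (𝓝[≠] 0) (𝓝[≠] 0) := by
    refine tendsto_nhdsWithin_iff.2 ⟨?_, ?_⟩
    · have : Tendsto (fun x : ℂ => 2 * x) (𝓝 0) (𝓝 (2*0)) := (continuous_const_mul 2).tendsto 0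
      rw [mul_zero] at this
      exact this.mono_left nhdsWithin_le_nhds
    · filter_upwards [self_mem_nhdsWithin] with x hx
      have : x ≠ 0 := hx
      simpa using this
  have h2 := h1.comp_tendsto ht
  have h3 : ((fun x : ℂ => x^(2*(N+1))) ∘ (fun x : ℂ => 2*x)) =O[𝓝[≠] 0] (fun x : ℂ => x^(2*(N+1))) := by
    simp only [Function.comp_def, mul_pow]
    exact isBigO_const_mul_self _ _ _
  have h4 := ((h1.const_mul_left 2).sub (h2.trans h3)).mul (isBigO_refl (fun x : ℂ => x⁻¹) (𝓝[≠] 0))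
  have hne : ∀ᶠ x : ℂ in 𝓝[≠] 0, Complex.sinh x ≠ 0 := by
    have ht := hasDerivAt_iff_tendsto_slope.1 (Complex.hasDerivAt_sinh 0)
    have hne : ∀ᶠ x : ℂ in 𝓝[≠] 0, slope Complex.sinh 0 x ≠ 0 := ht.eventually_ne (by simp)
    filter_upwards [hne] with x hx h
    simp [slope_def_field, h] at hx
  refine h4.congr' ?_ ?_
  · filter_upwards [self_mem_nhdsWithin, hne] with x hx hs
    have hx0 : x ≠ 0 := hx
    have hE := Complex.exp_ne_zero x
    have e2 : Complex.exp (2*x) = Complex.exp x * Complex.exp x := by rw [← Complex.exp_add]; ring_nf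
    have hsx : Complex.sinh x = (Complex.exp x * Complex.exp x - 1) / (2 * Complex.exp x) := by
      rw [Complex.sinh, Complex.exp_neg]; field_simp
    have hsub : Complex.exp x * Complex.exp x - 1 ≠ 0 := by
      intro h; rw [hsx, h] at hs; simp at hs
    have hs1 : Complex.exp x - 1 ≠ 0 := by
      intro h; apply hsub; linear_combination (Complex.exp x + 1) * h
    have hA : x * (Complex.sinh x)⁻¹ = 2 * (x / (Complex.exp x - 1)) - 2 * x / (Complex.exp (2*x) - 1) := by
      have hsub' : Complex.exp x ^ 2 - 1 ≠ 0 := by rw [sq]; exact hsub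
      rw [hsx, e2]; field_simp; ring
    have hB : ∑ n ∈ Finset.range (N+1), 2 * dseC n * x^(2*(n:ℤ)-1)
        = (∑ n ∈ Finset.range (N+1), 2 * dseC n * x^(2*n)) * x⁻¹ := by
      rw [Finset.sum_mul]
      refine Finset.sum_congr rfl (fun n _ => ?_)
      rw [zpow_sub_one₀ hx0]
      have : x^(2*(n:ℤ)) = x^(2*n) := by exact_mod_cast zpow_natCast x (2*n)
      rw [this]; ring
    have hC : (Complex.sinh x)⁻¹ = (2 * (x / (Complex.exp x - 1)) - 2 * x / (Complex.exp (2*x) - 1)) * x⁻¹ := by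
      rw [← hA]; field_simp
    rw [dseR, hB, hC, ← dse_sum_even, ← sub_mul]
    congr 1
    simp only [Function.comp_def, mul_sub, Finset.mul_sum]
    rw [show ∀ a b c d : ℂ, a - b - (c - d) = a - c - (b - d) by intros; ring, ← Finset.sum_sub_distrib]
    congr 1
    refine Finset.sum_congr rfl (fun k _ => ?_)
    rw [mul_pow]; ring
  · filter_upwards [self_mem_nhdsWithin] with x hx
    have : x ≠ 0 := hx
    rw [show 2*(N+1) = 2*N+1+1 by ring, pow_succ]
    field_simp

lemma dse_R_real (N : ℕ) : ∃ C : ℝ, 0 < C ∧ ∀ x : ℝ, x ≠ 0 → ‖dseR N (x:ℂ)‖ ≤ C * |x|^(2*N+1) := by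
  obtain ⟨C, hC, hb⟩ := (dse_R_isBigO N).exists_pos
  have hb := hb.bound
  rw [eventually_nhdsWithin_iff, Metric.eventually_nhds_iff] at hb
  obtain ⟨r, hr, hb⟩ := hb
  set D : ℝ := (Real.sinh r)⁻¹ * (r^(2*N+1))⁻¹ + ∑ n ∈ Finset.range (N+1), ‖2 * dseC n‖ * (r^(2*(N-n)+2))⁻¹ with hD
  have hsr : 0 < Real.sinh r := Real.sinh_pos_iff.2 hr
  have hD0 : 0 ≤ D := by positivity
  refine ⟨C + D, by positivity, fun x hx => ?_⟩
  rcases lt_or_ge |x| r with h | h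
  · have := hb (y := (x:ℂ)) (by simpa using h) (by simpa using hx)
    rw [norm_pow, Complex.norm_real, Real.norm_eq_abs] at this
    refine this.trans ?_
    gcongr; linarith
  · have hx0 : 0 < |x| := hr.trans_le h
    have : ‖dseR N (x:ℂ)‖ ≤ D * |x|^(2*N+1) := by
      rw [dseR, hD, add_mul, Finset.sum_mul]
      refine (norm_sub_le _ _).trans (add_le_add ?_ ((norm_sum_le _ _).trans (Finset.sum_le_sum fun n hn => ?_)))
      · rw [norm_inv, ← Complex.ofReal_sinh, Complex.norm_real, Real.norm_eq_abs, Real.abs_sinh, mul_assoc]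
        have h1 : Real.sinh r ≤ Real.sinh |x| := Real.sinh_le_sinh.2 h
        have h2 : 1 ≤ (r^(2*N+1))⁻¹ * |x|^(2*N+1) := by
          rw [inv_mul_eq_div, one_le_div (by positivity)]; gcongr
        calc (Real.sinh |x|)⁻¹ ≤ (Real.sinh r)⁻¹ := by gcongr
          _ ≤ _ := le_mul_of_one_le_right (by positivity) h2
      · rw [norm_mul, mul_assoc]
        gcongr
        rw [norm_zpow, Complex.norm_real, Real.norm_eq_abs, inv_mul_eq_div, le_div_iff₀ (by positivity)]
        have hn' : n ≤ N := by simpa [Nat.lt_succ_iff] using hn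
        have e : |x|^(2*N+1) = |x|^(2*(n:ℤ)-1) * |x|^(2*(N-n)+2) := by
          rw [← zpow_natCast, ← zpow_natCast, ← zpow_add₀ hx0.ne']
          congr 1; push_cast [hn']; ring
        rw [e]
        gcongr
    refine this.trans ?_
    gcongr; linarith

end


section
open MeasureTheory Asymptotics Filter Topology

/-- the basic integrand -/
noncomputable def dsek (m : ℤ) (z u : ℂ) : ℂ :=
  u^m * (Complex.exp (-(2*Complex.I*u*z)) / Complex.sinh u)

/-- the basic integral -/
noncomputable def dseK (e : ℝ) (m : ℤ) (z : ℂ) : ℂ := ∫ t : ℝ, dsek m z ((t:ℂ) + Complex.I * (e:ℂ))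

lemma dse_zpow_line {e η : ℝ} (he : 0 < e) (hη : 0 < η) (m : ℤ) :
    ∃ C : ℝ, 0 < C ∧ ∀ t : ℝ, ‖((t:ℂ) + Complex.I * (e:ℂ))^m‖ ≤ C * Real.exp (η * |t|) := by
  have hup : ∀ t : ℝ, ‖(t:ℂ) + Complex.I * (e:ℂ)‖ ≤ |t| + e := by
    intro t
    refine (norm_add_le _ _).trans ?_
    simp [abs_of_pos he]
  have hlow : ∀ t : ℝ, e ≤ ‖(t:ℂ) + Complex.I * (e:ℂ)‖ := by
    intro t
    have := Complex.abs_im_le_norm ((t:ℂ) + Complex.I * (e:ℂ))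
    simpa [abs_of_pos he] using this
  obtain ⟨n, rfl | rfl⟩ := m.eq_nat_or_neg
  · refine ⟨n.factorial / η^n * Real.exp (η * e), by positivity, fun t => ?_⟩
    rw [norm_zpow, zpow_natCast]
    calc _ ≤ (|t| + e)^n := by gcongr; exact hup t
      _ ≤ n.factorial / η^n * Real.exp (η * (|t| + e)) := dse_pow_le hη n (by positivity)
      _ = _ := by rw [mul_add, Real.exp_add]; ring
  · refine ⟨(e^n)⁻¹, by positivity, fun t => ?_⟩
    rw [norm_zpow, zpow_neg, zpow_natCast]
    have h1 : 1 ≤ Real.exp (η * |t|) := Real.one_le_exp (by positivity)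
    calc _ ≤ (e^n)⁻¹ := by gcongr; exact hlow t
      _ ≤ _ := le_mul_of_one_le_right (by positivity) h1

lemma dse_k_bound {e η : ℝ} (he : e ∈ Set.Ioo 0 Real.pi) (hη : 0 < η) (m : ℤ) :
    ∃ C : ℝ, 0 < C ∧ ∀ (t : ℝ) (z : ℂ), ‖dsek m z ((t:ℂ) + Complex.I * (e:ℂ))‖
      ≤ C * Real.exp (2 * e * z.re) * Real.exp ((2 * |z.im| - 1 + η) * |t|) := by
  obtain ⟨C, hC, h⟩ := dse_zpow_line he.1 hη m
  have hs := Real.sin_pos_of_pos_of_lt_pi he.1 he.2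
  refine ⟨C * (2 / Real.sin e), by positivity, fun t z => ?_⟩
  have h1 : Real.sin e * (Real.exp |t| / 2) ≤ ‖Complex.sinh ((t:ℂ) + Complex.I * (e:ℂ))‖ := by
    refine le_trans ?_ (dse_cosh_le t e)
    rw [abs_of_pos hs]
    gcongr; exact dse_half_exp_le_cosh t
  rw [dsek, norm_mul, norm_div, dse_norm_exp]
  have h2 : t * z.im ≤ |z.im| * |t| := by rw [mul_comm, ← abs_mul]; exact le_abs_self _
  calc _ ≤ (C * Real.exp (η * |t|)) * (Real.exp (2 * (|z.im| * |t| + e * z.re)) / (Real.sin e * (Real.exp |t| / 2))) := by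
        gcongr; exact h t
    _ = _ := by
      rw [show (2 * |z.im| - 1 + η) * |t| = 2 * |z.im| * |t| + (-|t|) + η * |t| by ring,
        show 2 * (|z.im| * |t| + e * z.re) = 2 * |z.im| * |t| + 2 * e * z.re by ring]
      simp only [Real.exp_add, Real.exp_neg]
      field_simp

lemma dse_sinh_ne {u : ℂ} (h : u.im ∈ Set.Ioo 0 Real.pi) : Complex.sinh u ≠ 0 := by
  intro h0
  have h1 := dse_cosh_le u.re u.im
  rw [mul_comm Complex.I, Complex.re_add_im, h0, norm_zero] at h1
  have hs := Real.sin_pos_of_pos_of_lt_pi h.1 h.2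
  have := mul_pos (abs_pos.2 hs.ne') (Real.cosh_pos u.re)
  linarith

lemma dse_ne_zero {u : ℂ} (h : u.im ∈ Set.Ioo 0 Real.pi) : u ≠ 0 := by
  rintro rfl
  simp at h

lemma dse_k_diff (m : ℤ) (z : ℂ) : DifferentiableOn ℂ (dsek m z) {u | u.im ∈ Set.Ioo 0 Real.pi} := by
  intro u hu
  have h0 := dse_sinh_ne hu
  have h1 := dse_ne_zero hu
  unfold dsek
  have hz : DifferentiableAt ℂ (fun u : ℂ => u^m) u := differentiableAt_zpow.2 (Or.inl h1)
  refine (hz.mul (DifferentiableAt.div (by fun_prop) (by fun_prop) h0)).differentiableWithinAt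

lemma dse_k_cont {e : ℝ} (he : e ∈ Set.Ioo 0 Real.pi) (m : ℤ) (z : ℂ) :
    Continuous (fun t : ℝ => dsek m z ((t:ℂ) + Complex.I * (e:ℂ))) := by
  refine (dse_k_diff m z).continuousOn.comp_continuous (by fun_prop) (fun t => ?_)
  simpa using he

lemma dse_k_integrable {e : ℝ} (he : e ∈ Set.Ioo 0 Real.pi) (m : ℤ) {z : ℂ} (hz : |z.im| < 1/2) :
    Integrable (fun t : ℝ => dsek m z ((t:ℂ) + Complex.I * (e:ℂ))) := by
  obtain ⟨C, hC, h⟩ := dse_k_bound he (show 0 < 1/2 - |z.im| by linarith) m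
  refine Integrable.mono' ((dse_integrable_exp (show 0 < 1/2 - |z.im| by linarith)).const_mul
    (C * Real.exp (2 * e * z.re))) (dse_k_cont he m z).aestronglyMeasurable (ae_of_all _ fun t => ?_)
  refine (h t z).trans (le_of_eq ?_)
  congr 2; ring

lemma dse_K_bound {e : ℝ} (he : e ∈ Set.Ioo 0 Real.pi) (m : ℤ) {z : ℂ} (hz : |z.im| < 1/2) :
    ∃ A : ℝ, ∀ s : ℝ, ‖dseK e m (z + s)‖ ≤ A * Real.exp (2 * e * s) := by
  obtain ⟨C, hC, h⟩ := dse_k_bound he (show 0 < 1/2 - |z.im| by linarith) m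
  have hi := (dse_integrable_exp (show 0 < 1/2 - |z.im| by linarith))
  refine ⟨C * Real.exp (2 * e * z.re) * ∫ t : ℝ, Real.exp (-((1/2 - |z.im|) * |t|)), fun s => ?_⟩
  refine (norm_integral_le_of_norm_le (hi.const_mul (C * Real.exp (2 * e * z.re) * Real.exp (2 * e * s)))
    (ae_of_all _ fun t => (h t (z+s)).trans (le_of_eq ?_))).trans (le_of_eq ?_)
  · simp only [Complex.add_re, Complex.add_im, Complex.ofReal_re, Complex.ofReal_im, add_zero, mul_add, Real.exp_add]
    rw [show -((1/2 - |z.im|) * |t|) = (2 * |z.im| - 1 + (1/2 - |z.im|)) * |t| by ring]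
    ring
  · rw [integral_const_mul]; ring

lemma dse_K_tendsto {e : ℝ} (he : e ∈ Set.Ioo 0 Real.pi) (m : ℤ) {z : ℂ} (hz : |z.im| < 1/2) :
    Tendsto (fun s : ℝ => dseK e m (z + s)) atBot (𝓝 0) := by
  obtain ⟨A, hA⟩ := dse_K_bound he m hz
  refine squeeze_zero_norm hA ?_
  have : Tendsto (fun s : ℝ => Real.exp (2 * e * s)) atBot (𝓝 0) :=
    Real.tendsto_exp_atBot.comp (tendsto_id.const_mul_atBot (by linarith [he.1]))
  simpa using this.const_mul A

lemma dse_K_deriv {e : ℝ} (he : e ∈ Set.Ioo 0 Real.pi) (m : ℤ) {z : ℂ} (hz : |z.im| < 1/2) :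
    HasDerivAt (dseK e m) (-2 * Complex.I * dseK e (m+1) z) z := by
  set r : ℝ := (1/2 - |z.im|)/2 with hr
  have hr0 : 0 < r := by rw [hr]; linarith
  obtain ⟨C, hC, h⟩ := dse_k_bound he hr0 (m+1)
  have key := (hasDerivAt_integral_of_dominated_loc_of_deriv_le (μ := volume) (𝕜 := ℂ)
    (F := fun z (t:ℝ) => dsek m z ((t:ℂ) + Complex.I * (e:ℂ)))
    (F' := fun z (t:ℝ) => (-2 * Complex.I) * dsek (m+1) z ((t:ℂ) + Complex.I * (e:ℂ)))
    (bound := fun t => 2 * (C * Real.exp (2 * e * (z.re + r))) * Real.exp (-(r * |t|)))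
    (x₀ := z) (Metric.ball_mem_nhds z hr0)
    (Eventually.of_forall fun z => (dse_k_cont he m z).aestronglyMeasurable)
    (dse_k_integrable he m hz)
    ((dse_k_cont he (m+1) z).const_mul _).aestronglyMeasurable ?_
    ((dse_integrable_exp hr0).const_mul _) ?_).2
  · rw [integral_const_mul] at key
    exact key
  · refine ae_of_all _ fun t x hx => ?_
    have hx' : ‖x - z‖ < r := by simpa [dist_eq_norm] using hx
    have h1 : x.re ≤ z.re + r := by
      have := (Complex.re_le_norm (x - z)).trans hx'.le
      simp only [Complex.sub_re] at this; linarith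
    have h2 : |x.im| ≤ |z.im| + r := by
      have h3 := (Complex.abs_im_le_norm (x - z)).trans hx'.le
      simp only [Complex.sub_im] at h3
      have := abs_sub_abs_le_abs_sub x.im z.im
      linarith
    rw [norm_mul]
    have : ‖(-2 * Complex.I : ℂ)‖ = 2 := by simp
    rw [this, mul_assoc]
    refine mul_le_mul_of_nonneg_left ((h t x).trans ?_) (by norm_num)
    have he0 := he.1
    gcongr
    rw [← neg_mul]
    gcongr
    linarith
  · refine ae_of_all _ fun t x hx => ?_
    have hu : ((t:ℂ) + Complex.I * (e:ℂ)) ≠ 0 := dse_ne_zero (by simpa using he)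
    simp only [dsek]
    set u := ((t:ℂ) + Complex.I * (e:ℂ))
    have : HasDerivAt (fun x : ℂ => -(2 * Complex.I * u * x)) (-(2 * Complex.I * u * 1)) x :=
      ((hasDerivAt_id x).const_mul _).neg
    refine HasDerivAt.congr_deriv ((this.cexp.div_const (Complex.sinh u)).const_mul (u^m)) ?_
    rw [zpow_add_one₀ hu]; ring

lemma dse_dec_k (m : ℤ) {z : ℂ} (hz : |z.im| < 1/2) : dseDec 0 Real.pi (dsek m z) := by
  set η : ℝ := (1/2 - |z.im|) with hη
  have hη0 : 0 < η := by rw [hη]; linarith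
  have hpow : ∃ C : ℝ, 0 < C ∧ ∀ t s : ℝ, 1 ≤ |t| → s ∈ Set.Icc 0 Real.pi →
      ‖((t:ℂ) + Complex.I * (s:ℂ))^m‖ ≤ C * Real.exp (η * |t|) := by
    obtain ⟨n, rfl | rfl⟩ := m.eq_nat_or_neg
    · refine ⟨n.factorial / η^n * Real.exp (η * Real.pi), by positivity, fun t s ht hs => ?_⟩
      rw [norm_zpow, zpow_natCast]
      have hup : ‖(t:ℂ) + Complex.I * (s:ℂ)‖ ≤ |t| + Real.pi := by
        refine (norm_add_le _ _).trans ?_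
        simp [abs_of_nonneg hs.1, hs.2]
      calc _ ≤ (|t| + Real.pi)^n := by gcongr
        _ ≤ n.factorial / η^n * Real.exp (η * (|t| + Real.pi)) := dse_pow_le hη0 n (by positivity)
        _ = _ := by rw [mul_add, Real.exp_add]; ring
    · refine ⟨1, one_pos, fun t s ht hs => ?_⟩
      rw [norm_zpow, zpow_neg, zpow_natCast, one_mul]
      have h1 : 1 ≤ Real.exp (η * |t|) := Real.one_le_exp (by positivity)
      have hlow : 1 ≤ ‖(t:ℂ) + Complex.I * (s:ℂ)‖ := by
        have := Complex.abs_re_le_norm ((t:ℂ) + Complex.I * (s:ℂ))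
        simp at this; linarith
      exact (inv_le_one_of_one_le₀ (one_le_pow₀ hlow)).trans h1
  obtain ⟨C, hC, h⟩ := hpow
  refine ⟨C * (3 * Real.exp (2 * (Real.pi * |z.re|))), η, hη0, fun t s ht hs => ?_⟩
  have h1 : Real.exp |t| / 3 ≤ ‖Complex.sinh ((t:ℂ) + Complex.I * (s:ℂ))‖ := by
    refine le_trans ?_ (dse_sinh_le t s)
    have := dse_abs_sinh t
    have hp := abs_nonneg (Real.sinh t)
    have : |t| * Real.exp |t| ≤ |t| * (3 * |Real.sinh t|) := by nlinarith
    have := le_of_mul_le_mul_left this (by linarith)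
    linarith
  rw [dsek, norm_mul, norm_div, dse_norm_exp]
  have h2 : t * z.im ≤ |z.im| * |t| := by rw [mul_comm, ← abs_mul]; exact le_abs_self _
  have h3 : s * z.re ≤ Real.pi * |z.re| := by
    calc s * z.re ≤ s * |z.re| := mul_le_mul_of_nonneg_left (le_abs_self _) hs.1
      _ ≤ _ := mul_le_mul_of_nonneg_right hs.2 (abs_nonneg _)
  calc _ ≤ (C * Real.exp (η * |t|)) * (Real.exp (2 * (|z.im| * |t| + Real.pi * |z.re|)) / (Real.exp |t| / 3)) := by
        gcongr; exact h t s ht hs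
    _ = _ := by
      rw [show -(η * |t|) = 2 * (|z.im| * |t|) + (-|t|) + η * |t| by rw [hη]; ring, mul_add 2]
      simp only [Real.exp_add, Real.exp_neg]
      field_simp

lemma dse_K_zero {e : ℝ} (he : e ∈ Set.Ioo 0 Real.pi) {z : ℂ} (hz : |z.im| < 1/2) :
    dseK e 0 z = 2 * (Real.pi:ℂ) * Complex.I * LiNeg 0 (-Complex.exp (2*(Real.pi:ℂ)*z)) := by
  have hpi := Real.pi_pos
  have hsh : dseK e 0 z = dseK (Real.pi/2) 0 z := by
    rcases le_total e (Real.pi/2) with h | h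
    · refine dse_shift h ((dse_dec_k 0 hz).mono he.1.le (by linarith)) ((dse_k_diff 0 z).continuousOn.mono ?_)
        ((dse_k_diff 0 z).mono ?_)
      · intro u hu; exact ⟨he.1.trans_le hu.1, by linarith [hu.2]⟩
      · intro u hu; exact ⟨he.1.trans hu.1, by linarith [hu.2]⟩
    · symm
      refine dse_shift h ((dse_dec_k 0 hz).mono (by linarith) he.2.le) ((dse_k_diff 0 z).continuousOn.mono ?_)
        ((dse_k_diff 0 z).mono ?_)
      · intro u hu; exact ⟨by linarith [hu.1], hu.2.trans_lt he.2⟩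
      · intro u hu; exact ⟨by linarith [hu.1], hu.2.trans he.2⟩
  have h1 : dseK (Real.pi/2) 0 z = ∫ t : ℝ, (-Complex.I * Complex.exp (Real.pi * z)) *
      (Complex.exp (-(2*Complex.I*(t:ℂ)*z)) / Complex.cosh (t:ℂ)) := by
    rw [dseK]; congr 1; ext t
    rw [dsek, zpow_zero, one_mul, show -(2*Complex.I*((t:ℂ) + Complex.I * ((Real.pi/2:ℝ):ℂ))*z)
      = Real.pi * z + -(2*Complex.I*(t:ℂ)*z) by push_cast; linear_combination (-(Real.pi:ℂ) * z) * Complex.I_sq, Complex.exp_add, 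
      show Complex.sinh ((t:ℂ) + Complex.I * ((Real.pi/2:ℝ):ℂ)) = Complex.I * Complex.cosh t by
        rw [mul_comm, Complex.sinh_add, Complex.sinh_mul_I, Complex.cosh_mul_I]
        push_cast
        rw [Complex.cos_pi_div_two, Complex.sin_pi_div_two]; ring]
    have hc : Complex.cosh (t:ℂ) ≠ 0 := by
      rw [← Complex.ofReal_cosh]; exact_mod_cast (Real.cosh_pos t).ne'
    have hI := Complex.I_ne_zero
    field_simp
    rw [Complex.I_sq]; ring
  rw [hsh, h1, integral_const_mul, dse_sech z hz, LiNeg]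
  have e2 : Complex.exp (2*(Real.pi:ℂ)*z) = Complex.exp (Real.pi*z) * Complex.exp (Real.pi*z) := by
    rw [← Complex.exp_add]; ring_nf
  have hE := Complex.exp_ne_zero (Real.pi*z)
  have hch : Complex.cosh ((Real.pi:ℂ)*z) = (1 + Complex.exp (Real.pi*z) * Complex.exp (Real.pi*z)) / (2 * Complex.exp (Real.pi*z)) := by
    rw [Complex.cosh, Complex.exp_neg]; field_simp; ring
  rw [hch, e2]
  beta_reduce
  rw [sub_neg_eq_add]
  by_cases h0 : 1 + Complex.exp (Real.pi*z) * Complex.exp (Real.pi*z) = 0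
  · rw [h0]; simp
  · field_simp

end


section
open MeasureTheory Asymptotics Filter Topology

lemma dse_slit {z : ℂ} (hz : |z.im| < 1/2) {t : ℝ} (ht : 0 ≤ t) :
    1 + t * Complex.exp (2*(Real.pi:ℂ)*z) ∈ Complex.slitPlane := by
  have hpi := Real.pi_pos
  have hre : (2*(Real.pi:ℂ)*z).re = 2*Real.pi*z.re := by simp
  have him : (2*(Real.pi:ℂ)*z).im = 2*Real.pi*z.im := by simp
  rw [Complex.mem_slitPlane_iff]
  simp only [Complex.add_re, Complex.add_im, Complex.re_ofReal_mul, Complex.im_ofReal_mul, Complex.one_re, Complex.one_im,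
    Complex.exp_re, Complex.exp_im, hre, him, zero_add]
  rcases ht.eq_or_lt with rfl | ht
  · left; simp
  by_cases h : Real.sin (2*Real.pi*z.im) = 0
  · left
    rw [abs_lt] at hz
    rw [Real.sin_eq_zero_iff_of_lt_of_lt (by nlinarith) (by nlinarith)] at h
    rw [h]; simp; positivity
  · right
    have := Real.exp_pos (2*Real.pi*z.re)
    exact mul_ne_zero ht.ne' (mul_ne_zero this.ne' h)

lemma dse_im_add {z : ℂ} (hz : |z.im| < 1/2) (s : ℝ) : |(z + s).im| < 1/2 := by simpa using hz

lemma dse_LiNeg_diff (m : ℕ) : DifferentiableOn ℂ (LiNeg m) {1}ᶜ := by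
  induction m with
  | zero =>
    intro w hw
    have : 1 - w ≠ 0 := by rw [sub_ne_zero]; exact fun h => hw h.symm
    exact (DifferentiableAt.div (by fun_prop) (by fun_prop) this).differentiableWithinAt
  | succ m ih => 
    exact differentiableOn_id.mul (ih.deriv isOpen_compl_singleton)

lemma dse_w_ne {z : ℂ} (hz : |z.im| < 1/2) : -Complex.exp (2*(Real.pi:ℂ)*z) ≠ 1 := by
  intro h
  have := Complex.slitPlane_ne_zero (dse_slit hz zero_le_one)
  apply this
  rw [Complex.ofReal_one, one_mul, ← h]; ring

lemma dse_w_deriv (z : ℂ) : HasDerivAt (fun z : ℂ => Complex.exp (2*(Real.pi:ℂ)*z))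
    (Complex.exp (2*(Real.pi:ℂ)*z) * (2*(Real.pi:ℂ))) z := by
  simpa using ((hasDerivAt_id z).const_mul (2*(Real.pi:ℂ))).cexp

lemma dse_strip_open : IsOpen {z : ℂ | |z.im| < 1/2} :=
  isOpen_lt (by fun_prop) (by fun_prop)

lemma dse_K_nat {e : ℝ} (he : e ∈ Set.Ioo 0 Real.pi) (m : ℕ) : ∀ {z : ℂ} (_ : |z.im| < 1/2),
    dseK e m z = 2 * ((Real.pi:ℂ) * Complex.I)^(m+1) * LiNeg m (-Complex.exp (2*(Real.pi:ℂ)*z)) := by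
  induction m with
  | zero => intro z hz; rw [Nat.cast_zero, dse_K_zero he hz]; ring
  | succ m ih =>
    intro z hz
    have h1 := dse_K_deriv he (m:ℤ) hz
    have hd : HasDerivAt (LiNeg m) (deriv (LiNeg m) (-Complex.exp (2*(Real.pi:ℂ)*z))) (-Complex.exp (2*(Real.pi:ℂ)*z)) :=
      ((dse_LiNeg_diff m).differentiableAt (isOpen_compl_singleton.mem_nhds (dse_w_ne hz))).hasDerivAt
    have h2 := (hd.comp z (dse_w_deriv z).neg).const_mul (2 * ((Real.pi:ℂ) * Complex.I)^(m+1))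
    have h3 := h2.congr_of_eventuallyEq (f₁ := dseK e m) (by
      filter_upwards [dse_strip_open.mem_nhds hz] with x hx
      exact ih hx)
    have h4 := h1.unique h3
    rw [LiNeg]
    push_cast
    have hI := Complex.I_sq
    apply mul_left_cancel₀ (show (-2 * Complex.I) ≠ 0 by simp)
    rw [h4]
    rw [pow_succ _ (m+1)]
    linear_combination (4 * ((Real.pi:ℂ)* Complex.I)^(m+1) * Real.pi * -Complex.exp (2*(Real.pi:ℂ)*z) * deriv (LiNeg m) (-Complex.exp (2*(Real.pi:ℂ)*z))) * hI

lemma dse_ofReal_deriv {f : ℂ → ℂ} {f' z : ℂ} {s : ℝ} (h : HasDerivAt f f' (z + s)) :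
    HasDerivAt (fun s : ℝ => f (z + s)) f' s := by
  have h1 : HasDerivAt (fun s : ℂ => f (z + s)) f' (s:ℂ) := h.comp_const_add z (s:ℂ)
  exact h1.comp_ofReal

lemma dse_exp_shift (z : ℂ) (s : ℝ) : Complex.exp (2*(Real.pi:ℂ)*(z+s))
    = (Real.exp (2*Real.pi*s) : ℝ) * Complex.exp (2*(Real.pi:ℂ)*z) := by
  rw [mul_add, Complex.exp_add]; push_cast; ring

lemma dse_K_neg_one {e : ℝ} (he : e ∈ Set.Ioo 0 Real.pi) {z : ℂ} (hz : |z.im| < 1/2) :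
    dseK e (-1) z = -2 * Complex.log (1 + Complex.exp (2*(Real.pi:ℂ)*z)) := by
  set D : ℝ → ℂ := fun s => dseK e (-1) (z+s) + 2 * Complex.log (1 + Complex.exp (2*(Real.pi:ℂ)*(z+s))) with hD
  have hder : ∀ s, HasDerivAt D 0 s := by
    intro s
    have hs := dse_im_add hz s
    have hsl : 1 + Complex.exp (2*(Real.pi:ℂ)*(z+s)) ∈ Complex.slitPlane := by
      simpa using dse_slit hs zero_le_one
    have h1 := dse_ofReal_deriv (dse_K_deriv he (-1) hs)
    have h2 := dse_ofReal_deriv ((((dse_w_deriv (z+s)).const_add 1).clog hsl).const_mul 2)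
    refine (h1.add h2).congr_deriv ?_
    have h0 := Complex.slitPlane_ne_zero hsl
    rw [show (-1:ℤ)+1 = 0 by norm_num, dse_K_zero he hs, LiNeg]
    beta_reduce
    rw [sub_neg_eq_add]
    field_simp
    linear_combination (4 * Real.pi * Complex.exp (2*(Real.pi:ℂ)*(z+s))) * Complex.I_sq
  have hconst : ∀ s, D s = D 0 := fun s =>
    is_const_of_deriv_eq_zero (fun s => (hder s).differentiableAt) (fun s => (hder s).deriv) s 0
  have hlim : Tendsto D atBot (𝓝 0) := by
    have h1 := dse_K_tendsto he (-1) hz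
    have h2 : Tendsto (fun s : ℝ => 2 * Complex.log (1 + Complex.exp (2*(Real.pi:ℂ)*(z+s)))) atBot (𝓝 (2 * Complex.log (1 + 0))) := by
      refine Tendsto.const_mul _ (Tendsto.clog (Tendsto.const_add _ ?_) (by simp))
      simp only [dse_exp_shift]
      have : Tendsto (fun s : ℝ => Real.exp (2*Real.pi*s)) atBot (𝓝 0) :=
        Real.tendsto_exp_atBot.comp (tendsto_id.const_mul_atBot (by positivity))
      have := (Complex.continuous_ofReal.tendsto 0).comp this
      simpa using this.mul_const (Complex.exp (2*(Real.pi:ℂ)*z))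
    simpa using h1.add h2
  have h0 : D 0 = 0 := tendsto_nhds_unique (tendsto_const_nhds.congr fun s => (hconst s).symm) hlim
  simp only [hD, Complex.ofReal_zero, add_zero] at h0
  linear_combination h0

lemma dse_log_int {w : ℂ} (hw : ∀ t : ℝ, t ∈ Set.Icc 0 1 → 1 - t * w ∈ Complex.slitPlane) :
    IntervalIntegrable (fun t : ℝ => Complex.log (1 - t * w) / (t:ℂ)) volume 0 1 := by
  set g : ℝ → ℂ := fun t => Complex.log (1 - t * w) with hg
  have hd : ∀ t ∈ Set.Icc (0:ℝ) 1, DifferentiableAt ℝ g t := by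
    intro t ht
    have h1 : DifferentiableAt ℝ (fun t : ℝ => 1 - (t:ℂ) * w) t := by
      have : DifferentiableAt ℝ (fun t : ℝ => (t:ℂ)) t := Complex.ofRealCLM.differentiableAt
      fun_prop
    exact (h1.hasDerivAt.clog_real (hw t ht)).differentiableAt
  have hdg : ContinuousOn (dslope g 0) (Set.Icc 0 1) := by
    intro t ht
    by_cases h : t = 0
    · subst h; exact (continuousAt_dslope_same.2 (hd 0 ht)).continuousWithinAt
    · exact ((continuousAt_dslope_of_ne h).2 (hd t ht).continuousAt).continuousWithinAt
  have hi : IntervalIntegrable (dslope g 0) volume 0 1 := by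
    apply ContinuousOn.intervalIntegrable
    rwa [Set.uIcc_of_le zero_le_one]
  refine hi.congr (fun t ht => ?_)
  rw [Set.uIoc_of_le zero_le_one] at ht
  rw [dslope_of_ne _ ht.1.ne', slope_def_module]
  simp [hg, div_eq_inv_mul]

lemma dse_K_neg_two {e : ℝ} (he : e ∈ Set.Ioo 0 Real.pi) {z : ℂ} (hz : |z.im| < 1/2) :
    dseK e (-2) z = 2 * ((Real.pi:ℂ) * Complex.I)⁻¹ * Li2 (-Complex.exp (2*(Real.pi:ℂ)*z)) := by
  have hpi := Real.pi_pos
  set w := -Complex.exp (2*(Real.pi:ℂ)*z) with hw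
  set f : ℝ → ℂ := fun t => dseK e (-2) (z + ((Real.log t / (2 * Real.pi) : ℝ) : ℂ)) with hf
  have hsl : ∀ t : ℝ, t ∈ Set.Icc 0 1 → 1 - t * w ∈ Complex.slitPlane := by
    intro t ht
    have := dse_slit hz ht.1
    rw [hw]; convert this using 1; ring
  have hder : ∀ t : ℝ, 0 < t → HasDerivAt f ((2 * Complex.I / Real.pi) * (Complex.log (1 - t * w) / t)) t := by
    intro t ht
    have hs := dse_im_add hz (Real.log t / (2 * Real.pi))
    have h1 := dse_ofReal_deriv (dse_K_deriv he (-2) hs)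
    have h2 : HasDerivAt (fun t : ℝ => Real.log t / (2 * Real.pi)) (t⁻¹ / (2*Real.pi)) t :=
      (Real.hasDerivAt_log ht.ne').div_const _
    have h3 := h1.scomp t h2
    refine HasDerivAt.congr_deriv (f := f) h3 ?_
    rw [show (-2:ℤ)+1 = -1 by norm_num, dse_K_neg_one he hs, dse_exp_shift,
      show 2 * Real.pi * (Real.log t / (2 * Real.pi)) = Real.log t by field_simp, Real.exp_log ht, hw,
      show 1 - (t:ℂ) * -Complex.exp (2*(Real.pi:ℂ)*z) = 1 + t * Complex.exp (2*(Real.pi:ℂ)*z) by ring, Complex.real_smul]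
    have : (t:ℂ) ≠ 0 := by exact_mod_cast ht.ne'
    have : (Real.pi:ℂ) ≠ 0 := by exact_mod_cast hpi.ne'
    push_cast
    field_simp
  have hint := (dse_log_int hsl).const_mul (2 * Complex.I / Real.pi)
  have ha : Tendsto f (𝓝[>] 0) (𝓝 0) :=
    (dse_K_tendsto he (-2) hz).comp (Real.tendsto_log_nhdsGT_zero.atBot_div_const (by positivity))
  have hb : Tendsto f (𝓝[<] 1) (𝓝 (f 1)) := (hder 1 one_pos).continuousAt.tendsto.mono_left nhdsWithin_le_nhds
  have := intervalIntegral.integral_eq_sub_of_hasDerivAt_of_tendsto zero_lt_one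
    (fun t ht => hder t ht.1) hint ha hb
  rw [intervalIntegral.integral_const_mul, sub_zero] at this
  have hf1 : f 1 = dseK e (-2) z := by simp [hf]
  rw [← hf1, ← this, Li2]
  have : (Real.pi:ℂ) ≠ 0 := by exact_mod_cast hpi.ne'
  have hI := Complex.I_ne_zero
  generalize (∫ t in (0:ℝ)..1, Complex.log (1 - (t:ℂ) * w) / (t:ℂ)) = J
  field_simp
  linear_combination J * Complex.I_sq

lemma dse_K_idx {e : ℝ} (he : e ∈ Set.Ioo 0 Real.pi) {z : ℂ} (hz : |z.im| < 1/2) (n : ℕ) :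
    dseK e (2*(n:ℤ)-2) z = 2 * ((Real.pi:ℂ) * Complex.I)^(2*(n:ℤ)-1) * LiIdx n (-Complex.exp (2*(Real.pi:ℂ)*z)) := by
  rcases n with _ | n
  · have := dse_K_neg_two he hz
    simpa [LiIdx] using this
  · have := dse_K_nat he (2*n) hz
    rw [LiIdx, if_neg (by omega), show 2*(n+1)-2 = 2*n by omega, show (2*((n+1:ℕ):ℤ)-2) = ((2*n:ℕ):ℤ) by push_cast; ring,
      show (2*((n+1:ℕ):ℤ)-1) = ((2*n+1:ℕ):ℤ) by push_cast; ring, zpow_natCast, this]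

end


section
open MeasureTheory Asymptotics Filter Topology

/-- the main integrand -/
noncomputable def dseF (τ : ℝ) (z u : ℂ) : ℂ :=
  Complex.exp (-(2*Complex.I*u*z)) / (4*u * Complex.sinh ((τ:ℂ)*u) * Complex.sinh u)

/-- the error integrand -/
noncomputable def dseE (N : ℕ) (τ : ℝ) (z u : ℂ) : ℂ :=
  Complex.exp (-(2*Complex.I*u*z)) / (4*u * Complex.sinh u) * dseR N ((τ:ℂ)*u)

lemma dse_E_eq (N : ℕ) {τ : ℝ} (hτ : 0 < τ) (z : ℂ) {u : ℂ} (hu : u ≠ 0) :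
    dseE N τ z u = dseF τ z u + ∑ n ∈ Finset.range (N+1),
      (-(dseC n / 2 * (τ:ℂ)^(2*(n:ℤ)-1))) * dsek (2*(n:ℤ)-2) z u := by
  have hτ' : (τ:ℂ) ≠ 0 := by exact_mod_cast hτ.ne'
  rw [dseE, dseR, mul_sub, sub_eq_add_neg, Finset.mul_sum, ← Finset.sum_neg_distrib]
  congr 1
  · rw [dseF]; simp only [div_eq_mul_inv, mul_inv]; ring
  · refine Finset.sum_congr rfl fun n _ => ?_
    rw [dsek, mul_zpow, show (2*(n:ℤ)-1) = (2*(n:ℤ)-2) + 1 by ring, zpow_add_one₀ hu]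
    simp only [div_eq_mul_inv, mul_inv]
    field_simp
    ring

lemma dse_F_eq (τ : ℝ) (z u : ℂ) :
    dseF τ z u = (Complex.sinh ((τ:ℂ)*u))⁻¹ * ((1/4) * dsek (-1) z u) := by
  rw [dseF, dsek, zpow_neg_one]; simp only [div_eq_mul_inv, mul_inv]; ring

lemma dse_F_dec {τ : ℝ} (hτ : 0 < τ) {z : ℂ} (hz : |z.im| < 1/2) : dseDec 0 Real.pi (dseF τ z) := by
  obtain ⟨C, c, hc, h⟩ := (dse_dec_k (-1) hz).const_mul (1/4)
  have hs : 0 < Real.sinh τ := Real.sinh_pos_iff.2 hτ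
  refine ⟨(Real.sinh τ)⁻¹ * C, c, hc, fun t s ht hsI => ?_⟩
  rw [dse_F_eq, norm_mul, norm_inv, mul_assoc]
  have h1 : Real.sinh τ ≤ ‖Complex.sinh ((τ:ℂ) * ((t:ℂ) + Complex.I * (s:ℂ)))‖ := by
    have := dse_sinh_le (τ*t) (τ*s)
    rw [show (τ:ℂ) * ((t:ℂ) + Complex.I * (s:ℂ)) = ((τ*t : ℝ):ℂ) + Complex.I * ((τ*s:ℝ):ℂ) by
      push_cast; ring]
    refine le_trans ?_ this
    rw [Real.abs_sinh, Real.sinh_le_sinh, abs_mul, abs_of_pos hτ]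
    nlinarith
  exact mul_le_mul (inv_anti₀ hs h1) (h t s ht hsI) (norm_nonneg _) (by positivity)

lemma dse_E_dec (N : ℕ) {τ : ℝ} (hτ : 0 < τ) {z : ℂ} (hz : |z.im| < 1/2) :
    dseDec 0 Real.pi (dseE N τ z) := by
  obtain ⟨C, c, hc, h⟩ := (dse_F_dec hτ hz).add
    (dseDec.sum (fun n => (dse_dec_k (2*(n:ℤ)-2) hz).const_mul (-(dseC n / 2 * (τ:ℂ)^(2*(n:ℤ)-1)))) (N+1))
  refine ⟨C, c, hc, fun t s ht hsI => ?_⟩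
  rw [dse_E_eq N hτ z]
  · exact h t s ht hsI
  · intro h0
    have := congrArg Complex.re h0
    simp at this
    rw [this] at ht; norm_num at ht

lemma dse_real_sinh_ne {u : ℂ} (hu : u ≠ 0) (h : u.im ∈ Set.Ico 0 Real.pi) : Complex.sinh u ≠ 0 := by
  rcases h.1.eq_or_lt with h0 | h0
  · have : u = (u.re : ℂ) := by apply Complex.ext <;> simp [← h0]
    rw [this, ← Complex.ofReal_sinh]
    have h2 : u.re ≠ 0 := by
      intro h3; apply hu; rw [this, h3]; simp
    exact_mod_cast Real.sinh_ne_zero.2 h2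
  · exact dse_sinh_ne ⟨h0, h.2⟩

lemma dse_mul_im (τ : ℝ) (u : ℂ) : ((τ:ℂ)*u).im = τ * u.im := by simp

lemma dse_mul_mem {τ : ℝ} (hτ : τ ∈ Set.Ioo (0:ℝ) 1) {u : ℂ} (h : u.im ∈ Set.Ico 0 Real.pi) :
    ((τ:ℂ)*u).im ∈ Set.Ico 0 Real.pi := by
  rw [dse_mul_im]
  exact ⟨mul_nonneg hτ.1.le h.1, by nlinarith [hτ.1, hτ.2, h.1, h.2]⟩

lemma dse_F_diffAt {τ : ℝ} (hτ : τ ∈ Set.Ioo (0:ℝ) 1) (z : ℂ) {u : ℂ} (hu : u ≠ 0)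
    (h : u.im ∈ Set.Ico 0 Real.pi) : DifferentiableAt ℂ (dseF τ z) u := by
  have hτ' : (τ:ℂ) ≠ 0 := by exact_mod_cast hτ.1.ne'
  have h1 := dse_real_sinh_ne hu h
  have h2 := dse_real_sinh_ne (mul_ne_zero hτ' hu) (dse_mul_mem hτ h)
  unfold dseF
  refine DifferentiableAt.div (by fun_prop) ?_ (mul_ne_zero (mul_ne_zero (mul_ne_zero (by norm_num) hu) h2) h1)
  refine ((differentiableAt_id.const_mul 4).mul ?_).mul ?_
  · exact (Complex.differentiable_sinh _).comp u (differentiableAt_id.const_mul (τ:ℂ))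
  · exact Complex.differentiable_sinh _

lemma dse_E_diffAt (N : ℕ) {τ : ℝ} (hτ : τ ∈ Set.Ioo (0:ℝ) 1) (z : ℂ) {u : ℂ} (hu : u ≠ 0)
    (h : u.im ∈ Set.Ico 0 Real.pi) : DifferentiableAt ℂ (dseE N τ z) u := by
  have h1 := dse_real_sinh_ne hu h
  have he : dseE N τ z =ᶠ[𝓝 u] fun u => dseF τ z u + ∑ n ∈ Finset.range (N+1),
      (-(dseC n / 2 * (τ:ℂ)^(2*(n:ℤ)-1))) * dsek (2*(n:ℤ)-2) z u := by
    filter_upwards [isOpen_ne.mem_nhds hu] with v hv using dse_E_eq N hτ.1 z hv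
  refine DifferentiableAt.congr_of_eventuallyEq ?_ he
  refine (dse_F_diffAt hτ z hu h).add (DifferentiableAt.fun_sum fun n _ => ?_)
  refine DifferentiableAt.const_mul ?_ _
  unfold dsek
  refine (differentiableAt_zpow.2 (Or.inl hu)).mul (DifferentiableAt.div (by fun_prop) ?_ h1)
  exact Complex.differentiable_sinh _

lemma dse_E_zero (N : ℕ) (hN : 1 ≤ N) {τ : ℝ} (hτ : 0 < τ) (z : ℂ) :
    ContinuousAt (dseE N τ z) 0 := by
  have hτ' : (τ:ℂ) ≠ 0 := by exact_mod_cast hτ.ne'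
  rw [continuousAt_iff_punctured_nhds]
  have h0 : dseE N τ z 0 = 0 := by simp [dseE]
  rw [h0]
  have ht : Tendsto (fun u : ℂ => (τ:ℂ)*u) (𝓝[≠] 0) (𝓝[≠] 0) := by
    refine tendsto_nhdsWithin_iff.2 ⟨?_, ?_⟩
    · have : Tendsto (fun u : ℂ => (τ:ℂ)*u) (𝓝 0) (𝓝 ((τ:ℂ)*0)) :=
        (continuous_const.mul continuous_id).tendsto 0
      rw [mul_zero] at this
      exact this.mono_left nhdsWithin_le_nhds
    · filter_upwards [self_mem_nhdsWithin] with u hu using mul_ne_zero hτ' hu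
  have hR : (fun u : ℂ => dseR N ((τ:ℂ)*u)) =O[𝓝[≠] 0] (fun u => u^(2*N+1)) := by
    refine ((dse_R_isBigO N).comp_tendsto ht).trans ?_
    refine IsBigO.of_bound (‖(τ:ℂ)‖^(2*N+1)) (Eventually.of_forall fun u => ?_)
    simp [mul_pow]
  have hsl : Tendsto (fun u : ℂ => u⁻¹ * Complex.sinh u) (𝓝[≠] 0) (𝓝 1) := by
    have := (Complex.hasDerivAt_sinh 0).tendsto_slope
    simp only [Complex.cosh_zero] at this
    refine this.congr fun u => ?_
    simp [slope_def_field, div_eq_inv_mul]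
  have hG : Tendsto (fun u : ℂ => Complex.exp (-(2*Complex.I*u*z)) / 4 * (u⁻¹ * Complex.sinh u)⁻¹)
      (𝓝[≠] 0) (𝓝 (1/4*1⁻¹)) := by
    refine Tendsto.mul ?_ (hsl.inv₀ one_ne_zero)
    have : Continuous (fun u : ℂ => Complex.exp (-(2*Complex.I*u*z)) / 4) := by fun_prop
    have := this.tendsto 0
    simp only [mul_zero, zero_mul, neg_zero, Complex.exp_zero] at this
    exact this.mono_left nhdsWithin_le_nhds
  have hall : dseE N τ z =O[𝓝[≠] 0] (fun u => u^(2*N-1)) := by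
    have h1 := ((hG.isBigO_one ℂ).mul (hR.mul (isBigO_refl (fun u : ℂ => (u^2)⁻¹) (𝓝[≠] 0))))
    refine (h1.congr' ?_ ?_)
    · filter_upwards [self_mem_nhdsWithin] with u hu
      have hu : u ≠ 0 := hu
      simp only [dseE, div_eq_mul_inv, mul_inv, inv_inv]
      field_simp
    · filter_upwards [self_mem_nhdsWithin] with u hu
      have hu : u ≠ 0 := hu
      rw [show 2*N+1 = (2*N-1) + 2 by omega, pow_add]
      field_simp
  refine hall.trans_tendsto ?_
  have : Continuous (fun u : ℂ => u^(2*N-1)) := by fun_prop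
  have := this.tendsto 0
  rw [zero_pow (by omega)] at this
  exact this.mono_left nhdsWithin_le_nhds

lemma dse_E_shift (N : ℕ) (hN : 1 ≤ N) {τ : ℝ} (hτ : τ ∈ Set.Ioo (0:ℝ) 1) {e : ℝ}
    (he : e ∈ Set.Ioo 0 Real.pi) {z : ℂ} (hz : |z.im| < 1/2) :
    ∫ t : ℝ, dseE N τ z (t + Complex.I * ((0:ℝ):ℂ)) = ∫ t : ℝ, dseE N τ z (t + Complex.I * (e:ℂ)) := by
  refine dse_shift he.1.le ((dse_E_dec N hτ.1 hz).mono le_rfl he.2.le) ?_ ?_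
  · intro u hu
    by_cases h0 : u = 0
    · rw [h0]; exact (dse_E_zero N hN hτ.1 z).continuousWithinAt
    · exact (dse_E_diffAt N hτ z h0 ⟨hu.1, hu.2.trans_lt he.2⟩).continuousAt.continuousWithinAt
  · intro u hu
    refine (dse_E_diffAt N hτ z ?_ ⟨hu.1.le, hu.2.trans he.2⟩).differentiableWithinAt
    exact dse_ne_zero ⟨hu.1, hu.2.trans he.2⟩

lemma dse_E_line (N : ℕ) {τ : ℝ} (hτ : τ ∈ Set.Ioo (0:ℝ) 1) {e : ℝ}
    (he : e ∈ Set.Ioo 0 Real.pi) {z : ℂ} (hz : |z.im| < 1/2) :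
    ∫ t : ℝ, dseE N τ z (t + Complex.I * (e:ℂ)) = (∫ t : ℝ, dseF τ z (t + Complex.I * (e:ℂ)))
      - ∑ n ∈ Finset.range (N+1), dseC n * ((Real.pi:ℂ)*Complex.I) ^ (2*(n:ℤ)-1) * (τ:ℂ) ^ (2*(n:ℤ)-1)
                * LiIdx n (-Complex.exp (2*(Real.pi:ℂ)*z)) := by
  have him : ∀ t : ℝ, ((t:ℂ) + Complex.I * (e:ℂ)).im = e := by intro t; simp
  have hne : ∀ t : ℝ, (t:ℂ) + Complex.I * (e:ℂ) ≠ 0 := fun t => dse_ne_zero (by rw [him]; exact he)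
  have hF : Integrable (fun t : ℝ => dseF τ z (t + Complex.I * (e:ℂ))) := by
    refine dse_line_integrable (dse_F_dec hτ.1 hz) ⟨he.1.le, he.2.le⟩ ?_
    refine continuous_iff_continuousAt.2 fun t => ?_
    have h1 := (dse_F_diffAt hτ z (hne t) (by rw [him]; exact ⟨he.1.le, he.2⟩)).continuousAt
    exact ContinuousAt.comp (f := fun t : ℝ => (t:ℂ) + Complex.I * (e:ℂ)) h1 (by fun_prop)
  have hk : ∀ n ∈ Finset.range (N+1), Integrable (fun t : ℝ =>
      (-(dseC n / 2 * (τ:ℂ)^(2*(n:ℤ)-1))) * dsek (2*(n:ℤ)-2) z (t + Complex.I * (e:ℂ))) :=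
    fun n _ => (dse_k_integrable he _ hz).const_mul _
  rw [integral_congr_ae (Eventually.of_forall fun t => dse_E_eq N hτ.1 z (hne t)),
    integral_add hF (integrable_finsetSum _ hk), integral_finsetSum _ hk, sub_eq_add_neg,
    ← Finset.sum_neg_distrib]
  congr 1
  refine Finset.sum_congr rfl fun n _ => ?_
  have := dse_K_idx he hz n
  rw [dseK] at this
  rw [integral_const_mul, this]
  ring

lemma dse_E_real (N : ℕ) (hN : 1 ≤ N) {δ : ℝ} (hδ : 0 < δ) : ∃ C : ℝ, 0 < C ∧ ∀ τ : ℝ, 0 < τ →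
    ∀ z : ℂ, |z.im| ≤ 1/2 - δ → ∀ t : ℝ, ‖dseE N τ z t‖ ≤ C * τ^(2*N+1) * Real.exp (-(δ * |t|)) := by
  obtain ⟨C, hC, hR⟩ := dse_R_real N
  set A : ℝ := (2*N-1).factorial / δ^(2*N-1) with hA
  set B : ℝ := (2*N).factorial / δ^(2*N) with hB
  have hA0 : 0 < A := by positivity
  have hB0 : 0 < B := by positivity
  refine ⟨C/4 * (A + 2 * B), by positivity, fun τ hτ z hz t => ?_⟩
  by_cases ht : t = 0
  · rw [ht]; simp only [dseE, Complex.ofReal_zero, mul_zero, zero_mul, div_zero, norm_zero]; positivity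
  have htp : 0 < |t| := abs_pos.2 ht
  have hs : 0 < |Real.sinh t| := abs_pos.2 (Real.sinh_ne_zero.2 ht)
  have h1 : ‖dseR N ((τ:ℂ)*(t:ℂ))‖ ≤ C * (τ*|t|)^(2*N+1) := by
    have := hR (τ*t) (mul_ne_zero hτ.ne' ht)
    rw [abs_mul, abs_of_pos hτ] at this
    simpa using this
  have h2 : ‖Complex.exp (-(2*Complex.I*(t:ℂ)*z))‖ ≤ Real.exp ((1 - 2*δ) * |t|) := by
    have := dse_norm_exp t 0 z
    simp only [Complex.ofReal_zero, mul_zero, add_zero, zero_mul] at this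
    rw [this]
    refine Real.exp_le_exp.2 ?_
    have h3 : t * z.im ≤ |t| * |z.im| := by rw [← abs_mul]; exact le_abs_self _
    nlinarith
  have h3 : ‖4*(t:ℂ)*Complex.sinh t‖ = 4 * |t| * |Real.sinh t| := by
    rw [norm_mul, norm_mul, ← Complex.ofReal_sinh, Complex.norm_real, Complex.norm_real]
    simp
  have h4 : Real.exp |t| / |Real.sinh t| ≤ (1 + 2*|t|) / |t| := by
    rw [div_le_div_iff₀ hs htp]
    have := dse_abs_sinh t
    linarith
  have hpA : |t|^(2*N-1) ≤ A * Real.exp (δ*|t|) := dse_pow_le hδ _ htp.le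
  have hpB : |t|^(2*N) ≤ B * Real.exp (δ*|t|) := dse_pow_le hδ _ htp.le
  rw [dseE, norm_mul, norm_div, h3]
  calc _ ≤ Real.exp ((1 - 2*δ) * |t|) / (4 * |t| * |Real.sinh t|) * (C * (τ*|t|)^(2*N+1)) := by
        gcongr
    _ = C/4 * τ^(2*N+1) * |t|^(2*N) * Real.exp (-(2*δ*|t|)) * (Real.exp |t| / |Real.sinh t|) := by
        rw [show (1 - 2*δ) * |t| = -(2*δ*|t|) + |t| by ring, Real.exp_add, mul_pow, pow_succ |t|]
        field_simp
    _ ≤ C/4 * τ^(2*N+1) * |t|^(2*N) * Real.exp (-(2*δ*|t|)) * ((1 + 2*|t|) / |t|) := by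
        gcongr
    _ = C/4 * τ^(2*N+1) * Real.exp (-(2*δ*|t|)) * (|t|^(2*N-1) + 2 * |t|^(2*N)) := by
        have : |t|^(2*N) = |t|^(2*N-1) * |t| := by rw [← pow_succ]; congr 1; omega
        rw [this]
        field_simp
    _ ≤ C/4 * τ^(2*N+1) * Real.exp (-(2*δ*|t|)) * (A * Real.exp (δ*|t|) + 2 * (B * Real.exp (δ*|t|))) := by
        gcongr
    _ = _ := by
        rw [show -(δ*|t|) = -(2*δ*|t|) + δ*|t| by ring, Real.exp_add]; ring


end

/-- the uniform expansion of the double-sinh contour integral. -/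
theorem double_sinh_integral_expansion (N : ℕ) (hN : 1 ≤ N) (δ : ℝ)
    (hδ : δ ∈ Set.Ioo (0:ℝ) (1/2)) :
    ∃ C > (0:ℝ), ∃ τ₀ ∈ Set.Ioo (0:ℝ) 1, ∀ τ ∈ Set.Ioo (0:ℝ) τ₀,
      ∀ ε ∈ Set.Ioo (0:ℝ) Real.pi, ∀ z : ℂ, |z.im| ≤ 1/2 - δ →
      ‖(∫ t : ℝ, Complex.exp (-(2*Complex.I*((t:ℂ)+Complex.I*(ε:ℂ))*z)) /
            (4*((t:ℂ)+Complex.I*(ε:ℂ)) * Complex.sinh ((τ:ℂ)*((t:ℂ)+Complex.I*(ε:ℂ)))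
              * Complex.sinh ((t:ℂ)+Complex.I*(ε:ℂ))))
          - ∑ n ∈ Finset.range (N+1),
              ((1 - (2:ℂ)^(2*(n:ℤ)-1)) * ((bernoulli (2*n) : ℚ) : ℂ)
                  / (Nat.factorial (2*n) : ℂ))
                * ((Real.pi:ℂ)*Complex.I) ^ (2*(n:ℤ)-1) * (τ:ℂ) ^ (2*(n:ℤ)-1)
                * LiIdx n (-Complex.exp (2*(Real.pi:ℂ)*z))‖
        ≤ C * τ^(2*N+1) := by
  obtain ⟨C, hC, hE⟩ := dse_E_real N hN hδ.1
  have hI := dse_integrable_exp hδ.1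
  have hI0 : 0 ≤ ∫ t : ℝ, Real.exp (-(δ*|t|)) := integral_nonneg fun t => (Real.exp_pos _).le
  refine ⟨C * ((∫ t : ℝ, Real.exp (-(δ*|t|))) + 1), by positivity, 1/2, by norm_num, ?_⟩
  intro τ hτ ε hε z hz
  have hτ1 : τ ∈ Set.Ioo (0:ℝ) 1 := ⟨hτ.1, hτ.2.trans (by norm_num)⟩
  have hz' : |z.im| < 1/2 := by linarith [hδ.1]
  have h1 := dse_E_line N hτ1 hε hz'
  rw [← dse_E_shift N hN hτ1 hε hz'] at h1
  simp only [Complex.ofReal_zero, mul_zero, add_zero] at h1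
  have h2 : ‖∫ t : ℝ, dseE N τ z t‖ ≤ ∫ t : ℝ, C * τ^(2*N+1) * Real.exp (-(δ * |t|)) :=
    norm_integral_le_of_norm_le (hI.const_mul _) (Filter.Eventually.of_forall (hE τ hτ.1 z hz))
  rw [h1, integral_const_mul] at h2
  simp only [dseF, dseC] at h2
  refine h2.trans ?_
  have h3 : 0 ≤ C * τ^(2*N+1) := by have := hτ.1; positivity
  nlinarith
end

section
/- Fix ζ ∈ ℝ and ω ∈ ℂ with 0 < Im ω < 1/2, and let f and g be as defined in the context. Then there exist constants C > 0, c > 0, T > 0 and b₀ ∈ (0,1) such that for all t = t₁ + it₂ with |t₁| ≥ T and t₂ ∈ (−1/2, 0), and for all b ∈ (0, b₀): |e^{f(t)/b²} g(t)| ≤ C·e^{−c|t₁|/b²}. -/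
open MeasureTheory

lemma li2_integrable (z : ℂ) (hz : z.im ≠ 0) :
    IntervalIntegrable (fun t : ℝ => Complex.log (1 - (t:ℂ) * z) / (t:ℂ)) volume 0 1 := by
  have hs : ∀ t : ℝ, (1 - (t:ℂ) * z) ∈ Complex.slitPlane := by
    intro t
    rw [Complex.mem_slitPlane_iff]
    by_cases ht : t = 0
    · left; simp [ht]
    · right; simp [ht, hz]
  have hd : ∀ t : ℝ, DifferentiableAt ℝ (fun t : ℝ => Complex.log (1 - (t:ℂ) * z)) t := by
    intro t
    have h1 : HasDerivAt (fun t : ℝ => (1 - (t:ℂ) * z)) (-(1 * z)) t := by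
      have := (Complex.ofRealCLM.hasDerivAt (x := t)).mul_const z
      simpa using this.const_sub 1
    exact (h1.clog_real (hs t)).differentiableAt
  have hc : Continuous (dslope (fun t : ℝ => Complex.log (1 - (t:ℂ) * z)) 0) := by
    rw [← continuousOn_univ]
    rw [continuousOn_dslope Filter.univ_mem]
    exact ⟨fun t _ => (hd t).continuousAt.continuousWithinAt, hd 0⟩
  refine (hc.intervalIntegrable 0 1).congr_ae ?_
  have : ∀ᵐ t : ℝ ∂(volume.restrict (Set.uIoc (0:ℝ) 1)), t ∈ Set.uIoc (0:ℝ) 1 :=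
    ae_restrict_mem measurableSet_uIoc
  filter_upwards [this] with t ht
  rw [Set.uIoc_of_le zero_le_one] at ht
  rw [dslope_of_ne _ ht.1.ne', slope_def_module]
  simp [div_eq_inv_mul]

lemma arg_bound (w : ℂ) (h : ‖w‖ ≤ 1/2) : |(1 - w).arg| ≤ 3/2 * ‖w‖ := by
  have := Complex.norm_log_one_add_half_le_self (z := -w) (by simpa using h)
  rw [norm_neg, ← sub_eq_add_neg] at this
  have h2 := Complex.abs_im_le_norm (Complex.log (1 - w))
  rw [Complex.log_im] at h2
  exact h2.trans this

lemma li2_im (z : ℂ) (hz : z.im ≠ 0) :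
    (Li2 z).im = -∫ t in (0:ℝ)..1, (1 - (t:ℂ) * z).arg / t := by
  unfold Li2
  rw [Complex.neg_im]
  congr 1
  have := Complex.imCLM.intervalIntegral_comp_comm (li2_integrable z hz)
  rw [Complex.imCLM_apply] at this
  rw [← this]
  congr 1
  ext t
  rw [Complex.imCLM_apply, Complex.div_ofReal_im, Complex.log_im]

lemma arg_integrable (z : ℂ) (hz : z.im ≠ 0) :
    IntervalIntegrable (fun t : ℝ => (1 - (t:ℂ) * z).arg / t) volume 0 1 := by
  have h := li2_integrable z hz
  have h2 : IntervalIntegrable (fun t : ℝ => (Complex.log (1 - (t:ℂ) * z) / (t:ℂ)).im) volume 0 1 :=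
    ⟨h.1.im, h.2.im⟩
  refine h2.congr ?_
  intro t _
  simp only [Complex.div_ofReal_im, Complex.log_im]

lemma small_bound (z : ℂ) (hz : z.im ≠ 0) (a : ℝ) (ha : 0 ≤ a) (h : a * ‖z‖ ≤ 1/2) :
    |∫ t in (0:ℝ)..a, (1 - (t:ℂ) * z).arg / t| ≤ 1 := by
  have := intervalIntegral.norm_integral_le_of_norm_le_const (a := 0) (b := a) (C := 3/2 * ‖z‖)
    (f := fun t : ℝ => (1 - (t:ℂ) * z).arg / t) (by
      intro t ht
      rw [Set.uIoc_of_le ha] at ht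
      have hn : ‖(t:ℂ) * z‖ = t * ‖z‖ := by
        rw [norm_mul, Complex.norm_real, Real.norm_of_nonneg ht.1.le]
      have hle : t * ‖z‖ ≤ a * ‖z‖ := mul_le_mul_of_nonneg_right ht.2 (norm_nonneg _)
      have hb := arg_bound ((t:ℂ) * z) (by rw [hn]; linarith)
      rw [hn] at hb
      rw [Real.norm_eq_abs, abs_div, abs_of_pos ht.1, div_le_iff₀ ht.1]
      linarith)
  rw [Real.norm_eq_abs, sub_zero, abs_of_nonneg ha] at this
  linarith

lemma arg_split (z : ℂ) (hz : z.im ≠ 0) (s : ℝ) (hs : 0 < s) :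
    (1 - (s:ℂ) * z).arg = (-z).arg + (1 - ((s:ℂ) * z)⁻¹).arg := by
  have hz0 : z ≠ 0 := by rintro rfl; simp at hz
  have hs0 : (s:ℂ) ≠ 0 := by exact_mod_cast hs.ne'
  have e : 1 - (s:ℂ) * z = (s:ℂ) * ((-z) * (1 - ((s:ℂ) * z)⁻¹)) := by
    field_simp
    ring
  rw [e, Complex.arg_real_mul _ hs]
  have hns : 0 < Complex.normSq ((s:ℂ) * z) := Complex.normSq_pos.2 (mul_ne_zero hs0 hz0)
  have him : (1 - ((s:ℂ) * z)⁻¹).im = s * z.im / Complex.normSq ((s:ℂ) * z) := by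
    simp only [Complex.sub_im, Complex.inv_im, Complex.one_im, Complex.re_ofReal_mul, Complex.im_ofReal_mul]
    ring
  have hne : (1 - ((s:ℂ) * z)⁻¹).im ≠ 0 := by
    rw [him]; positivity
  apply Complex.arg_mul
  · exact neg_ne_zero.2 hz0
  · intro h; rw [h] at hne; simp at hne
  · rcases lt_or_gt_of_ne hz with h | h
    · have h1 : 0 ≤ (-z).arg := Complex.arg_nonneg_iff.2 (by simp; linarith)
      have h2 : (1 - ((s:ℂ) * z)⁻¹).arg < 0 := Complex.arg_neg_iff.2 (by
        rw [him]; exact div_neg_of_neg_of_pos (mul_neg_of_pos_of_neg hs h) hns)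
      exact ⟨by linarith [Complex.neg_pi_lt_arg (1 - ((s:ℂ) * z)⁻¹)], by
        linarith [Complex.arg_le_pi (-z)]⟩
    · have h1 : (-z).arg < 0 := Complex.arg_neg_iff.2 (by simp; linarith)
      have h2 : 0 ≤ (1 - ((s:ℂ) * z)⁻¹).arg := Complex.arg_nonneg_iff.2 (by
        rw [him]; positivity)
      exact ⟨by linarith [Complex.neg_pi_lt_arg (-z)], by
        linarith [Complex.arg_le_pi (1 - ((s:ℂ) * z)⁻¹)]⟩

lemma point_bound (z : ℂ) (hz : z.im ≠ 0) (s : ℝ) (hs : 0 < s) :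
    |(1 - (s:ℂ) * z).arg / s - (-z).arg / s| ≤ 14 / ‖z‖ * s ^ (-2 : ℤ) := by
  have hz0 : z ≠ 0 := by rintro rfl; simp at hz
  have hr : 0 < ‖z‖ := norm_pos_iff.2 hz0
  have hn : ‖((s:ℂ) * z)⁻¹‖ = (s * ‖z‖)⁻¹ := by
    rw [norm_inv, norm_mul, Complex.norm_real, Real.norm_of_nonneg hs.le]
  have key : |(1 - ((s:ℂ) * z)⁻¹).arg| ≤ 14 * (s * ‖z‖)⁻¹ := by
    by_cases h : (s * ‖z‖)⁻¹ ≤ 1/2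
    · have := arg_bound _ (hn.le.trans h)
      rw [hn] at this
      have : 0 < (s * ‖z‖)⁻¹ := by positivity
      linarith
    · have := Complex.abs_arg_le_pi (1 - ((s:ℂ) * z)⁻¹)
      have := Real.pi_lt_four
      push Not at h
      linarith
  rw [← sub_div, arg_split z hz s hs, add_sub_cancel_left, abs_div, abs_of_pos hs, div_le_iff₀ hs]
  refine key.trans (le_of_eq ?_)
  rw [zpow_neg, zpow_ofNat]
  field_simp

lemma large_bound (z : ℂ) (hz : z.im ≠ 0) (h1 : 1 ≤ ‖z‖) :
    |(Li2 z).im + (-z).arg * Real.log ‖z‖| ≤ 40 := by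
  have hr : 0 < ‖z‖ := by linarith
  set a : ℝ := 1 / (2 * ‖z‖) with ha
  have ha0 : 0 < a := by positivity
  have ha1 : a ≤ 1 := by rw [ha, div_le_one (by positivity)]; linarith
  have hI := arg_integrable z hz
  have hIa : IntervalIntegrable (fun t : ℝ => (1 - (t:ℂ) * z).arg / t) volume 0 a :=
    hI.mono_set (by rw [Set.uIcc_of_le ha0.le, Set.uIcc_of_le zero_le_one]; exact Set.Icc_subset_Icc_right ha1)
  have hIb : IntervalIntegrable (fun t : ℝ => (1 - (t:ℂ) * z).arg / t) volume a 1 :=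
    hI.mono_set (by rw [Set.uIcc_of_le ha1, Set.uIcc_of_le zero_le_one]; exact Set.Icc_subset_Icc_left ha0.le)
  have hn0 : (0:ℝ) ∉ Set.uIcc a 1 := by
    rw [Set.uIcc_of_le ha1]; intro h; linarith [h.1]
  have hIc : IntervalIntegrable (fun t : ℝ => (-z).arg / t) volume a 1 := by
    apply ContinuousOn.intervalIntegrable
    apply ContinuousOn.div continuousOn_const continuousOn_id
    intro x hx h
    exact hn0 (by simpa [← h] using hx)
  have hId : IntervalIntegrable (fun t : ℝ => 14 / ‖z‖ * t ^ (-2 : ℤ)) volume a 1 :=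
    (intervalIntegral.intervalIntegrable_zpow (Or.inr hn0)).const_mul _
  have hsm := small_bound z hz a ha0.le (by rw [ha]; apply le_of_eq; field_simp)
  have hlg : |∫ t in a..1, ((1 - (t:ℂ) * z).arg / t - (-z).arg / t)| ≤ 28 := by
    have := intervalIntegral.norm_integral_le_of_norm_le ha1
      (f := fun t : ℝ => (1 - (t:ℂ) * z).arg / t - (-z).arg / t)
      (g := fun t : ℝ => 14 / ‖z‖ * t ^ (-2 : ℤ))
      (Filter.Eventually.of_forall fun t ht => point_bound z hz t (ha0.trans ht.1)) hId
    refine this.trans ?_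
    rw [intervalIntegral.integral_const_mul, integral_zpow (Or.inr ⟨by norm_num, hn0⟩)]
    have : a ^ (-2 + 1 : ℤ) = 2 * ‖z‖ := by
      norm_num [ha, zpow_neg]
    rw [this]
    norm_num
    have e : 14 / ‖z‖ * ((1 - 2 * ‖z‖) / -1) = 28 - 14 / ‖z‖ := by field_simp; ring
    have : 0 < 14 / ‖z‖ := by positivity
    first
      | linarith
      | (have e2 : 14 / ‖z‖ * (2 * ‖z‖ - 1) = 28 - 14 / ‖z‖ := by field_simp; ring
         linarith)
  rw [intervalIntegral.integral_sub hIb hIc] at hlg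
  have hlog : ∫ t in a..1, (-z).arg / t = (-z).arg * (Real.log 2 + Real.log ‖z‖) := by
    have : ∀ t : ℝ, (-z).arg / t = (-z).arg * (1 / t) := fun t => by ring
    simp_rw [this]
    rw [intervalIntegral.integral_const_mul, integral_one_div hn0, ha, one_div_one_div,
      Real.log_mul (by norm_num) hr.ne']
  rw [hlog] at hlg
  rw [li2_im z hz, ← intervalIntegral.integral_add_adjacent_intervals hIa hIb]
  have h2 : |(-z).arg * Real.log 2| ≤ 4 := by
    rw [abs_mul]
    have e1 := Complex.abs_arg_le_pi (-z)
    have e2 := Real.pi_lt_four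
    have e3 : |Real.log 2| ≤ 1 := by
      rw [abs_of_pos (Real.log_pos (by norm_num))]
      linarith [Real.log_two_lt_d9]
    calc _ ≤ 4 * 1 := mul_le_mul (by linarith) e3 (abs_nonneg _) (by norm_num)
      _ = 4 := by norm_num
  rw [abs_le] at *
  constructor <;> linarith [hsm.1, hsm.2, hlg.1, hlg.2, h2.1, h2.2]

lemma exp_im_ne (u : ℂ) (h1 : |u.im| < Real.pi) (h0 : u.im ≠ 0) : (-Complex.exp u).im ≠ 0 := by
  rw [Complex.neg_im, Complex.exp_im, neg_ne_zero]
  refine mul_ne_zero (Real.exp_pos _).ne' ?_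
  rw [abs_lt] at h1
  intro h
  exact h0 ((Real.sin_eq_zero_iff_of_lt_of_lt h1.1 h1.2).1 h)

lemma exp_large (u : ℂ) (h1 : |u.im| < Real.pi) (h0 : u.im ≠ 0) (hr : 0 ≤ u.re) :
    |(Li2 (-Complex.exp u)).im + u.im * u.re| ≤ 40 := by
  have := large_bound _ (exp_im_ne u h1 h0) (by
    rw [norm_neg, Complex.norm_exp]; exact Real.one_le_exp hr)
  rw [neg_neg, norm_neg, Complex.norm_exp, Real.log_exp, ← Complex.log_im,
    Complex.log_exp (abs_lt.1 h1).1 (abs_lt.1 h1).2.le] at this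
  exact this

lemma exp_small (u : ℂ) (h1 : |u.im| < Real.pi) (h0 : u.im ≠ 0) (hr : u.re ≤ -1) :
    |(Li2 (-Complex.exp u)).im| ≤ 1 := by
  rw [li2_im _ (exp_im_ne u h1 h0), abs_neg]
  apply small_bound _ (exp_im_ne u h1 h0) 1 zero_le_one
  rw [norm_neg, Complex.norm_exp, one_mul]
  calc Real.exp u.re ≤ Real.exp (-1) := Real.exp_le_exp.2 hr
    _ ≤ 1/2 := by linarith [Real.exp_neg_one_lt_d9]

lemma gM_bound (t : ℂ) (ht : 1 ≤ |t.re|) : ‖gM t‖ ≤ Real.exp 1 := by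
  unfold gM
  rw [Complex.norm_exp]
  apply Real.exp_le_exp.2
  set w := 1 - Complex.exp (2*(Real.pi:ℂ)*t) with hw
  have e1 : ((Real.pi:ℂ) * t - Complex.log w / 2).re = Real.pi * t.re - Real.log ‖w‖ / 2 := by
    rw [Complex.sub_re, Complex.re_ofReal_mul]
    congr 1
    have : Complex.log w / 2 = Complex.log w / ((2:ℝ):ℂ) := by norm_num
    rw [this, Complex.div_ofReal_re, Complex.log_re]
  rw [e1]
  have hne : ‖Complex.exp (2*(Real.pi:ℂ)*t)‖ = Real.exp (2 * Real.pi * t.re) := by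
    rw [Complex.norm_exp]; congr 1
    have : 2*(Real.pi:ℂ)*t = ((2*Real.pi : ℝ):ℂ) * t := by push_cast; ring
    rw [this, Complex.re_ofReal_mul]
  have hpi := Real.pi_gt_three
  have hl2 := Real.log_two_lt_d9
  rcases le_abs.1 ht with h | h
  · have hx : 1 ≤ 2 * Real.pi * t.re := by nlinarith
    have h2 : 2 ≤ Real.exp (2 * Real.pi * t.re) := by
      linarith [Real.add_one_le_exp (2 * Real.pi * t.re)]
    have hb : Real.exp (2 * Real.pi * t.re) / 2 ≤ ‖w‖ := by
      have := norm_sub_norm_le (Complex.exp (2*(Real.pi:ℂ)*t)) 1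
      rw [norm_sub_rev, ← hw, hne, norm_one] at this
      linarith
    have := Real.log_le_log (by positivity) hb
    rw [Real.log_div (Real.exp_pos _).ne' (by norm_num), Real.log_exp] at this
    linarith
  · have hx : 2 * Real.pi * t.re ≤ -1 := by nlinarith
    have h2 : Real.exp (2 * Real.pi * t.re) ≤ 1/2 :=
      (Real.exp_le_exp.2 hx).trans (by linarith [Real.exp_neg_one_lt_d9])
    have hb : 1 / 2 ≤ ‖w‖ := by
      have := norm_sub_norm_le 1 (Complex.exp (2*(Real.pi:ℂ)*t))
      rw [← hw, hne, norm_one] at this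
      linarith
    have := Real.log_le_log (by positivity) hb
    rw [one_div, Real.log_inv] at this
    nlinarith

lemma fMt_re (ζ : ℝ) (ω t : ℂ) : (fMt ζ ω t).re =
    -((Li2 (-Complex.exp (2*(Real.pi:ℂ)*(ζ:ℂ)))).im
      + (Li2 (-Complex.exp (2*(Real.pi:ℂ)*(t-(ζ:ℂ))))).im
      - (Li2 (-Complex.exp (2*(Real.pi:ℂ)*(t+Complex.I/2)))).im) / (2 * Real.pi)
    - 2 * Real.pi * (t.re * ω.im + t.im * ω.re) + Real.pi * t.re := by
  unfold fMt
  generalize Li2 (-Complex.exp (2*(Real.pi:ℂ)*(ζ:ℂ))) = A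
  generalize Li2 (-Complex.exp (2*(Real.pi:ℂ)*(t-(ζ:ℂ)))) = B
  generalize Li2 (-Complex.exp (2*(Real.pi:ℂ)*(t+Complex.I/2))) = D
  have hp : (Real.pi:ℂ) ≠ 0 := by exact_mod_cast Real.pi_ne_zero
  have e1 : -(A + B - D) / (2*(Real.pi:ℂ)*Complex.I)
      = (Complex.I * (A + B - D)) / ((2*Real.pi : ℝ):ℂ) := by
    push_cast
    field_simp
    rw [Complex.I_sq]; ring
  have e2 : Complex.I*(Real.pi:ℂ)*(ζ:ℂ)^2 = Complex.I * ((Real.pi * ζ^2 : ℝ) : ℂ) := by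
    push_cast; ring
  have e3 : 2*Complex.I*(Real.pi:ℂ)*t*ω = ((2 * Real.pi : ℝ) : ℂ) * (Complex.I * (t * ω)) := by
    push_cast; ring
  have e4 : Complex.I*(Real.pi:ℂ)/6 = Complex.I * ((Real.pi / 6 : ℝ) : ℂ) := by
    push_cast; ring
  rw [e1, e2, e3, e4]
  simp only [Complex.add_re, Complex.div_ofReal_re, Complex.re_ofReal_mul, Complex.I_mul_re,
    Complex.ofReal_im, Complex.mul_im, Complex.add_im, Complex.sub_im]
  ring

lemma fMt_bound (ζ : ℝ) (ω : ℂ) : ∃ K > (0:ℝ), ∀ t : ℂ, |ζ| + 1 ≤ |t.re| →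
    t.im ∈ Set.Ioo (-(1:ℝ)/2) 0 →
    (fMt ζ ω t).re ≤ -(Real.pi * min (1 - 2 * ω.im) (2 * ω.im)) * |t.re| + K := by
  set L := (Li2 (-Complex.exp (2*(Real.pi:ℂ)*(ζ:ℂ)))).im with hL
  refine ⟨|L| + 80 + 10 * |ω.re| + 10 * |ζ|, by positivity, ?_⟩
  intro t ht hti
  have hpi := Real.pi_gt_three
  have hpi4 := Real.pi_lt_four
  rw [fMt_re, ← hL]
  set u := 2*(Real.pi:ℂ)*(t-(ζ:ℂ)) with hu
  set v := 2*(Real.pi:ℂ)*(t+Complex.I/2) with hv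
  have ur : u.re = 2 * Real.pi * (t.re - ζ) := by simp [hu]
  have ui : u.im = 2 * Real.pi * t.im := by simp [hu]
  have vr : v.re = 2 * Real.pi * t.re := by simp [hv]
  have vi : v.im = 2 * Real.pi * (t.im + 1/2) := by simp [hv]
  have hti1 := hti.1
  have hti2 := hti.2
  have u1 : |u.im| < Real.pi := by rw [ui, abs_lt]; constructor <;> nlinarith
  have v1 : |v.im| < Real.pi := by rw [vi, abs_lt]; constructor <;> nlinarith
  have u0 : u.im ≠ 0 := by rw [ui]; exact (by nlinarith : 2 * Real.pi * t.im < 0).ne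
  have v0 : v.im ≠ 0 := by rw [vi]; exact (by nlinarith : 0 < 2 * Real.pi * (t.im + 1/2)).ne'
  have hω : -(2 * Real.pi * (t.im * ω.re)) ≤ 10 * |ω.re| := by
    have h1 : |t.im| ≤ 1/2 := by rw [abs_le]; constructor <;> linarith
    calc -(2 * Real.pi * (t.im * ω.re)) ≤ |2 * Real.pi * (t.im * ω.re)| := neg_le_abs _
      _ = (2 * Real.pi * |t.im|) * |ω.re| := by
        rw [abs_mul, abs_mul t.im, abs_of_pos (by positivity : 0 < 2 * Real.pi)]; ring
      _ ≤ 10 * |ω.re| := by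
        apply mul_le_mul_of_nonneg_right _ (abs_nonneg _)
        nlinarith [abs_nonneg t.im]
  have hdiv : ∀ x : ℝ, ∀ M : ℝ, |x| ≤ M → -x / (2 * Real.pi) ≤ M := by
    intro x M hx
    rw [div_le_iff₀ (by positivity)]
    have : 0 ≤ M := (abs_nonneg x).trans hx
    nlinarith [neg_le_abs x]
  have hLl := abs_le.1 (le_refl |L|)
  rcases le_or_gt 0 t.re with h | h
  · rw [abs_of_nonneg h] at ht ⊢
    have A := abs_le.1 (exp_large u u1 u0 (by
      rw [ur]; have := le_abs_self ζ; have : 0 ≤ t.re - ζ := by linarith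
      positivity))
    have B := abs_le.1 (exp_large v v1 v0 (by rw [vr]; positivity))
    set X := (Li2 (-Complex.exp u)).im
    set Y := (Li2 (-Complex.exp v)).im
    have H := hdiv (L + (X + u.im * u.re) - (Y + v.im * v.re)) (|L| + 80) (by
      rw [abs_le]; constructor <;> linarith [A.1, A.2, B.1, B.2, hLl.1, hLl.2])
    have e : -(L + (X + u.im * u.re) - (Y + v.im * v.re)) / (2 * Real.pi)
        = -(L + X - Y) / (2 * Real.pi) + Real.pi * t.re + 2 * Real.pi * t.im * ζ := by
      rw [ur, ui, vr, vi]; field_simp; ring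
    rw [e] at H
    have hz : -(2 * Real.pi * t.im * ζ) ≤ 10 * |ζ| := by
      have h1 : |t.im| ≤ 1/2 := by rw [abs_le]; constructor <;> linarith
      calc -(2 * Real.pi * t.im * ζ) ≤ |2 * Real.pi * t.im * ζ| := neg_le_abs _
        _ = (2 * Real.pi * |t.im|) * |ζ| := by
          rw [abs_mul, abs_mul _ t.im, abs_of_pos (by positivity : 0 < 2 * Real.pi)]
        _ ≤ 10 * |ζ| := by
          apply mul_le_mul_of_nonneg_right _ (abs_nonneg _)
          nlinarith [abs_nonneg t.im]
    have hm : Real.pi * min (1 - 2 * ω.im) (2 * ω.im) * t.re ≤ Real.pi * (2 * ω.im) * t.re := by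
      gcongr; exact min_le_right _ _
    linarith
  · rw [abs_of_neg h] at ht ⊢
    have A := abs_le.1 (exp_small u u1 u0 (by
      rw [ur]; have := neg_le_abs ζ; have : t.re - ζ ≤ -1 := by linarith
      nlinarith))
    have B := abs_le.1 (exp_small v v1 v0 (by
      rw [vr]; have : t.re ≤ -1 := by linarith [abs_nonneg ζ]
      nlinarith))
    set X := (Li2 (-Complex.exp u)).im
    set Y := (Li2 (-Complex.exp v)).im
    have H := hdiv (L + X - Y) (|L| + 80) (by
      rw [abs_le]; constructor <;> linarith [A.1, A.2, B.1, B.2, hLl.1, hLl.2])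
    have hm : Real.pi * min (1 - 2 * ω.im) (2 * ω.im) * (-t.re)
        ≤ Real.pi * (1 - 2 * ω.im) * (-t.re) := by
      have : 0 ≤ -t.re := by linarith
      gcongr; exact min_le_left _ _
    have := abs_nonneg ζ
    linarith

/-- exponential decay of the integrand `e^{f(t)/b²} g(t)` for `𝓜`. -/
theorem M_integrand_decay (ζ : ℝ) (ω : ℂ) (hω1 : 0 < ω.im) (hω2 : ω.im < 1/2) :
    ∃ C > (0:ℝ), ∃ c > (0:ℝ), ∃ T > (0:ℝ), ∃ b₀ ∈ Set.Ioo (0:ℝ) 1, ∀ t : ℂ,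
      T ≤ |t.re| → t.im ∈ Set.Ioo (-(1:ℝ)/2) 0 → ∀ b ∈ Set.Ioo (0:ℝ) b₀,
      ‖Complex.exp (fMt ζ ω t / (b:ℂ)^2) * gM t‖ ≤ C * Real.exp (-(c * |t.re| / b^2)) := by
  obtain ⟨K, hK, hf⟩ := fMt_bound ζ ω
  set a := Real.pi * min (1 - 2 * ω.im) (2 * ω.im) with ha
  have ha0 : 0 < a := mul_pos Real.pi_pos (lt_min (by linarith) (by linarith))
  refine ⟨Real.exp 1, Real.exp_pos _, a / 2, by positivity, |ζ| + 1 + 2 * K / a, by positivity,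
    1/2, ⟨by norm_num, by norm_num⟩, ?_⟩
  intro t ht hti b hb
  have hKa : 0 < 2 * K / a := by positivity
  have h1 := hf t (by linarith) hti
  have hg := gM_bound t (by linarith [abs_nonneg ζ])
  have h2 : 2 * K ≤ |t.re| * a := by
    rw [← div_le_iff₀ ha0]; linarith [abs_nonneg ζ]
  rw [norm_mul, mul_comm]
  refine mul_le_mul hg ?_ (norm_nonneg _) (Real.exp_pos _).le
  rw [Complex.norm_exp, ← Complex.ofReal_pow, Complex.div_ofReal_re]
  apply Real.exp_le_exp.2
  rw [← neg_div]
  have hb0 := hb.1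
  apply div_le_div_of_nonneg_right _ (by positivity)
  linarith
end

section
/- Let ζ ∈ ℝ and ω ∈ ℂ with 0 < Im ω < 1/2, set t₀ := (1/(2π))·Log(e^{πζ} cosh(πω)/sinh(π(ζ+ω))), g(t₀) := e^{πt₀ − (1/2)Log(1−e^{2πt₀})}, and A := πi·cosh(πζ)/(sinh(πt₀)·cosh(π(t₀−ζ))). Then e^{πi/4}·g(t₀)·√(2π)/√(−A) = √((coth(π(ζ+ω))+1)/2), where all square roots are principal branches. -/
open MeasureTheory

lemma aux_exp : Complex.exp ((Real.pi:ℂ) * Complex.I / 2) = Complex.I := by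
  rw [mul_div_right_comm]
  exact Complex.exp_pi_div_two_mul_I

lemma aux_pos (a : ℝ) (y : ℂ) (h1 : 0 < y.im) (h2 : y.im < Real.pi/2) :
    0 < (Complex.cosh y * Complex.sinh ((a:ℂ) + y)).im := by
  have e : Complex.cosh y * Complex.sinh ((a:ℂ) + y)
      = (Complex.sinh (a + 2*y) + Complex.sinh a)/2 := by
    have : (a:ℂ) + 2*y = (a + y) + y := by ring
    have h3 : Complex.sinh (a:ℂ) = Complex.sinh ((a + y) - y) := by ring_nf
    rw [this, h3, Complex.sinh_add ((a:ℂ)+y) y, Complex.sinh_sub ((a:ℂ)+y) y]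
    ring
  have e2 : (Complex.sinh (a + 2*y)).im = Real.cosh (a + 2*y.re) * Real.sin (2*y.im) := by
    have : (a:ℂ) + 2*y = ((a + 2*y.re : ℝ):ℂ) + ((2*y.im : ℝ):ℂ) * Complex.I := by
      apply Complex.ext <;> simp
    rw [this, Complex.sinh_add, Complex.sinh_mul_I, Complex.cosh_mul_I]
    simp only [← Complex.ofReal_sinh, ← Complex.ofReal_cosh, ← Complex.ofReal_sin,
      ← Complex.ofReal_cos]
    simp only [Complex.add_im, Complex.mul_im, Complex.mul_re, Complex.ofReal_im, Complex.ofReal_re,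
      Complex.I_re, Complex.I_im]
    ring
  have e3 : (Complex.sinh (a:ℂ)).im = 0 := by rw [← Complex.ofReal_sinh]; simp
  have hs : 0 < Real.sin (2*y.im) := Real.sin_pos_of_pos_of_lt_pi (by linarith) (by linarith)
  have hc := Real.cosh_pos (a + 2*y.re)
  rw [e]
  have : ((Complex.sinh (a + 2*y) + Complex.sinh a)/2).im
    = Real.cosh (a + 2*y.re) * Real.sin (2*y.im) / 2 := by
    rw [Complex.div_ofNat_im, Complex.add_im, e2, e3]; simp
  rw [this]; positivity

lemma aux_v (a : ℝ) (y : ℂ) (h1 : 0 < y.im) (h2 : y.im < Real.pi/2) :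
    0 < (-(Complex.cosh (a:ℂ) * Complex.exp (-((a:ℂ)+y)) / Complex.cosh y)).im := by
  have hs : 0 < Real.sin (2*y.im) := Real.sin_pos_of_pos_of_lt_pi (by linarith) (by linarith)
  have hc := Real.cosh_pos a
  have key : (-(Complex.cosh (a:ℂ) * Complex.exp (-((a:ℂ)+y)) / Complex.cosh y))⁻¹
      = ((-(Real.exp a / (2 * Real.cosh a)) : ℝ) : ℂ) * (Complex.exp (2*y) + 1) := by
    have : Complex.cosh y = (Complex.exp y + (Complex.exp y)⁻¹)/2 := by
      rw [Complex.cosh, Complex.exp_neg]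
    rw [inv_neg, inv_div, Complex.exp_neg, Complex.exp_add, this, show Complex.exp (2*y) = Complex.exp y ^ 2 by
      rw [← Complex.exp_nat_mul]; norm_num]
    push_cast
    have hc' : Complex.cosh (a:ℂ) ≠ 0 := by
      rw [← Complex.ofReal_cosh]; exact_mod_cast hc.ne'
    have := Complex.exp_ne_zero y
    have := Complex.exp_ne_zero (a:ℂ)
    field_simp
  have him : ((-(Complex.cosh (a:ℂ) * Complex.exp (-((a:ℂ)+y)) / Complex.cosh y))⁻¹).im < 0 := by
    rw [key, Complex.im_ofReal_mul, Complex.add_im, Complex.exp_im]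
    have : (2*y).im = 2*y.im := by simp
    rw [this, Complex.one_im, add_zero]
    have : 0 < Real.exp a / (2 * Real.cosh a) * (Real.exp (2*y).re * Real.sin (2*y.im)) := by
      positivity
    linarith
  rw [Complex.inv_im] at him
  by_contra hcon
  have : 0 ≤ -(-(Complex.cosh (a:ℂ) * Complex.exp (-((a:ℂ)+y)) / Complex.cosh y)).im := by linarith
  have := div_nonneg this (Complex.normSq_nonneg (-(Complex.cosh (a:ℂ) * Complex.exp (-((a:ℂ)+y)) / Complex.cosh y)))
  linarith

lemma aux_arg {v : ℂ} (h : 0 < v.im) : 0 < v.arg ∧ v.arg < Real.pi := by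
  refine ⟨?_, ?_⟩
  · rcases (Complex.arg_nonneg_iff.2 h.le).lt_or_eq with h' | h'
    · exact h'
    · have := (Complex.arg_eq_zero_iff.1 h'.symm).2; linarith
  · exact Complex.arg_lt_pi_iff.2 (Or.inr h.ne')

lemma aux_log {u : ℂ} (h : 0 < u.im) :
    Complex.log u⁻¹ - Complex.log (1 - u⁻¹) = - Complex.log (u - 1) := by
  have hv : 0 < (u-1).im := by simpa using h
  have hu := aux_arg h
  have hv' := aux_arg hv
  have hu0 : u ≠ 0 := by rintro rfl; simp at h
  have hv0 : u - 1 ≠ 0 := by intro h0; rw [h0] at hv; simp at hv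
  have e : Complex.log (1 - u⁻¹) = Complex.log (u-1) - Complex.log u := by
    have : 1 - u⁻¹ = Complex.exp (Complex.log (u-1) - Complex.log u) := by
      rw [Complex.exp_sub, Complex.exp_log hu0, Complex.exp_log hv0]; field_simp
    rw [this, Complex.log_exp]
    · rw [Complex.sub_im, Complex.log_im, Complex.log_im]; linarith
    · rw [Complex.sub_im, Complex.log_im, Complex.log_im]; linarith
  rw [e, Complex.log_inv _ hu.2.ne]; ring

lemma aux_A (a y T : ℂ) (hc : Complex.cosh a ≠ 0) (hy : Complex.cosh y ≠ 0)
    (hz : Complex.sinh (a+y) ≠ 0)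
    (hT : Complex.exp T ^ 2 = Complex.exp a * Complex.cosh y / Complex.sinh (a+y)) :
    Complex.sinh T * Complex.cosh (T - a)
      = Complex.cosh a ^ 2 / (4 * (Complex.cosh y * Complex.sinh (a+y))) := by
  have hE := Complex.exp_ne_zero T
  have hp := Complex.exp_ne_zero a
  have hq := Complex.exp_ne_zero y
  have e1 : Complex.sinh T * Complex.cosh (T - a)
     = (Complex.exp T ^ 2 - 1) * (Complex.exp T ^ 2 + Complex.exp a ^ 2)
        / (4 * Complex.exp a * Complex.exp T ^ 2) := by
    rw [Complex.sinh, Complex.cosh, neg_sub, Complex.exp_sub, Complex.exp_sub, Complex.exp_neg]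
    field_simp
    ring
  have e2 : Complex.exp a * Complex.cosh y - Complex.sinh (a+y)
      = Complex.cosh a * Complex.exp (-y) := by
    rw [Complex.cosh, Complex.cosh, Complex.sinh, neg_add, Complex.exp_add, Complex.exp_add]
    simp only [Complex.exp_neg]; field_simp; ring
  have e3 : Complex.exp a * Complex.cosh y + Complex.exp a ^ 2 * Complex.sinh (a+y)
      = Complex.exp a ^ 2 * Complex.cosh a * Complex.exp y := by
    rw [Complex.cosh, Complex.cosh, Complex.sinh, neg_add, Complex.exp_add, Complex.exp_add]
    simp only [Complex.exp_neg]; field_simp; ring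
  have e4 : Complex.exp (-y) * Complex.exp y = 1 := by rw [← Complex.exp_add]; simp
  rw [e1, hT]
  have e5 : (Complex.exp a * Complex.cosh y / Complex.sinh (a+y) - 1)
      = Complex.cosh a * Complex.exp (-y) / Complex.sinh (a+y) := by rw [← e2]; field_simp
  have e6 : (Complex.exp a * Complex.cosh y / Complex.sinh (a+y) + Complex.exp a ^ 2)
      = Complex.exp a ^ 2 * Complex.cosh a * Complex.exp y / Complex.sinh (a+y) := by
    rw [← e3]; field_simp
  rw [e5, e6, Complex.exp_neg]
  field_simp

lemma aux_main (a : ℝ) (y t₀ A T : ℂ) (h1 : 0 < y.im) (h2 : y.im < Real.pi/2)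
    (hTt : (Real.pi:ℂ) * t₀ = T)
    (hT : T = Complex.log (Complex.exp (a:ℂ) * Complex.cosh y / Complex.sinh ((a:ℂ)+y)) / 2)
    (hA : A = (Real.pi:ℂ) * Complex.I * Complex.cosh (a:ℂ)
      / (Complex.sinh T * Complex.cosh (T - a))) :
    Complex.exp ((Real.pi:ℂ)*Complex.I/4) * gM t₀ * ((2*(Real.pi:ℂ)) ^ ((1:ℂ)/2)) / ((-A) ^ ((1:ℂ)/2))
      = ((Complex.cosh ((a:ℂ)+y) / Complex.sinh ((a:ℂ)+y) + 1)/2) ^ ((1:ℂ)/2) := by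
  have hpos := aux_pos a y h1 h2
  have hv := aux_v a y h1 h2
  have hy : Complex.cosh y ≠ 0 := by intro h; rw [h] at hpos; simp at hpos
  have hz : Complex.sinh ((a:ℂ)+y) ≠ 0 := by intro h; rw [h] at hpos; simp at hpos
  have hc : Complex.cosh (a:ℂ) ≠ 0 := by
    rw [← Complex.ofReal_cosh]; exact_mod_cast (Real.cosh_pos a).ne'
  have hpi : (Real.pi:ℂ) ≠ 0 := by exact_mod_cast Real.pi_ne_zero
  have hw0 : Complex.exp (a:ℂ) * Complex.cosh y / Complex.sinh ((a:ℂ)+y) ≠ 0 :=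
    div_ne_zero (mul_ne_zero (Complex.exp_ne_zero _) hy) hz
  have hE : Complex.exp T ^ 2 = Complex.exp (a:ℂ) * Complex.cosh y / Complex.sinh ((a:ℂ)+y) := by
    rw [← Complex.exp_nat_mul, hT]
    rw [show ((2:ℕ):ℂ) * (Complex.log (Complex.exp (a:ℂ) * Complex.cosh y / Complex.sinh ((a:ℂ)+y)) / 2)
      = Complex.log (Complex.exp (a:ℂ) * Complex.cosh y / Complex.sinh ((a:ℂ)+y)) by push_cast; ring]
    exact Complex.exp_log hw0
  rw [aux_A _ _ _ hc hy hz hE] at hA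
  -- the value of -A
  have hB : -A = ((4 * Real.pi / Real.cosh a : ℝ) : ℂ) *
      (-Complex.I * (Complex.cosh y * Complex.sinh ((a:ℂ)+y))) := by
    rw [hA]; push_cast; field_simp
  have hBre : 0 < (-A).re := by
    rw [hB, Complex.re_ofReal_mul]
    have : (-Complex.I * (Complex.cosh y * Complex.sinh ((a:ℂ)+y))).re
      = (Complex.cosh y * Complex.sinh ((a:ℂ)+y)).im := by
      rw [neg_mul, Complex.neg_re, Complex.I_mul_re, neg_neg]
    rw [this]
    have := Real.cosh_pos a
    have := Real.pi_pos
    positivity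
  have hB0 : -A ≠ 0 := by intro h; rw [h] at hBre; simp at hBre
  have hBarg := abs_lt.1 (Complex.abs_arg_lt_pi_div_two_iff.2 (Or.inl hBre))
  set v := -(Complex.cosh (a:ℂ) * Complex.exp (-((a:ℂ)+y)) / Complex.cosh y) with hvdef
  have hv0 : v ≠ 0 := by intro h; rw [h] at hv; simp at hv
  have hvarg := aux_arg hv
  have hu : 0 < (v+1).im := by simpa using hv
  have huw : (v+1)⁻¹ = Complex.exp (a:ℂ) * Complex.cosh y / Complex.sinh ((a:ℂ)+y) := by
    rw [inv_eq_iff_eq_inv, inv_div, hvdef, eq_div_iff (mul_ne_zero (Complex.exp_ne_zero _) hy)]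
    have hp := Complex.exp_ne_zero (a:ℂ)
    have hq := Complex.exp_ne_zero y
    have e2 : Complex.sinh (a+y) = Complex.exp a * Complex.cosh y
      - Complex.exp a * Complex.cosh a * Complex.exp (-(a+y)) := by
      rw [Complex.cosh, Complex.cosh, Complex.sinh, neg_add, Complex.exp_add, Complex.exp_add]
      simp only [Complex.exp_neg]; field_simp; ring
    rw [e2]; field_simp; ring
  have hg : gM t₀ = Complex.exp (-Complex.log v / 2) := by
    unfold gM
    have e1 : Complex.exp (2 * (Real.pi:ℂ) * t₀) = (v+1)⁻¹ := by
      rw [mul_assoc, hTt, huw, ← hE, ← Complex.exp_nat_mul]; norm_num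
    rw [e1, hTt, hT, ← huw]
    have := aux_log hu
    rw [add_sub_cancel_right] at this
    rw [← this]; ring_nf
  have h2pi : (2*(Real.pi:ℂ)) ≠ 0 := mul_ne_zero two_ne_zero hpi
  have h2log : (Complex.log (2*(Real.pi:ℂ))).im = 0 := by
    have : (2*(Real.pi:ℂ)) = ((2*Real.pi : ℝ):ℂ) := by push_cast; rfl
    rw [Complex.log_im, this, Complex.arg_ofReal_of_nonneg (by positivity)]
  set L := (Real.pi:ℂ) * Complex.I / 2 - Complex.log v + Complex.log (2*(Real.pi:ℂ))
    - Complex.log (-A) with hL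
  have hLim : L.im = Real.pi/2 - v.arg - (-A).arg := by
    rw [hL, Complex.sub_im, Complex.add_im, Complex.sub_im, h2log, Complex.log_im, Complex.log_im]
    simp
  have hr : (Complex.cosh ((a:ℂ)+y) / Complex.sinh ((a:ℂ)+y) + 1)/2 = Complex.exp L := by
    rw [hL, Complex.exp_sub, Complex.exp_add, Complex.exp_sub, Complex.exp_log hv0,
      Complex.exp_log h2pi, Complex.exp_log hB0, aux_exp]
    have e : Complex.cosh ((a:ℂ)+y) = Complex.exp ((a:ℂ)+y) - Complex.sinh ((a:ℂ)+y) := by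
      rw [← Complex.cosh_add_sinh]; ring
    rw [e, hA, hvdef, Complex.exp_neg]
    have := Complex.exp_ne_zero ((a:ℂ)+y)
    have := Complex.I_ne_zero
    field_simp
    ring
  have hr0 := Complex.exp_ne_zero L
  rw [hr, Complex.cpow_def_of_ne_zero hr0, Complex.cpow_def_of_ne_zero hB0,
    Complex.cpow_def_of_ne_zero h2pi, hg,
    Complex.log_exp (by rw [hLim]; linarith) (by rw [hLim]; linarith),
    ← Complex.exp_add, ← Complex.exp_add, ← Complex.exp_sub, hL]
  congr 1
  ring

/-- simplification of the leading coefficient in the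
semiclassical asymptotics of `𝓜`. -/
theorem M_coefficient_simplification (ζ : ℝ) (ω : ℂ) (hω1 : 0 < ω.im) (hω2 : ω.im < 1/2)
    (t₀ : ℂ)
    (ht₀ : t₀ = (1/(2*(Real.pi:ℂ))) *
      Complex.log (Complex.exp ((Real.pi:ℂ)*(ζ:ℂ)) * Complex.cosh ((Real.pi:ℂ)*ω)
        / Complex.sinh ((Real.pi:ℂ)*((ζ:ℂ)+ω))))
    (A : ℂ)
    (hA : A = (Real.pi:ℂ) * Complex.I * Complex.cosh ((Real.pi:ℂ)*(ζ:ℂ))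
      / (Complex.sinh ((Real.pi:ℂ)*t₀) * Complex.cosh ((Real.pi:ℂ)*(t₀-(ζ:ℂ))))) :
    Complex.exp ((Real.pi:ℂ)*Complex.I/4) * gM t₀ * ((2*(Real.pi:ℂ)) ^ ((1:ℂ)/2)) / ((-A) ^ ((1:ℂ)/2))
      = ((Complex.cosh ((Real.pi:ℂ)*((ζ:ℂ)+ω)) / Complex.sinh ((Real.pi:ℂ)*((ζ:ℂ)+ω)) + 1)/2)
          ^ ((1:ℂ)/2) := by
  have hpi : (Real.pi:ℂ) ≠ 0 := by exact_mod_cast Real.pi_ne_zero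
  have him : ((Real.pi:ℂ) * ω).im = Real.pi * ω.im := Complex.im_ofReal_mul _ _
  have hp := Real.pi_pos
  have h := aux_main (Real.pi * ζ) ((Real.pi:ℂ) * ω) t₀ A ((Real.pi:ℂ) * t₀)
    (by rw [him]; positivity) (by rw [him]; nlinarith) rfl
    (by
      rw [ht₀]; push_cast
      rw [← mul_add]
      field_simp)
    (by rw [hA]; push_cast; rw [← mul_sub])
  push_cast at h
  rw [← mul_add] at h
  exact h
end

section
/- Fix σ, μ ∈ ℝ and δ ∈ (0, 1/8), and let f and g be as defined in the context. Then there exist constants C > 0, c > 0, T > 0 and b₀ ∈ (0,1) such that for all t = t₁ + it₂ with |t₁| ≥ T and t₂ ∈ (−1/2, −1/4 − δ), and for all b ∈ (0, b₀): |e^{f(t)/b²} g(t)| ≤ C·e^{−c|t₁|/b²}. -/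
open MeasureTheory

theorem Li2_integrable (w : ℂ) (hw : 0 < w.im) :
    IntervalIntegrable (fun s : ℝ => Complex.log (1 - (s:ℂ) * w) / (s:ℂ)) volume 0 1 := by
  have hslit : ∀ s : ℝ, 1 - (s:ℂ) * w ∈ Complex.slitPlane := by
    intro s
    rw [Complex.mem_slitPlane_iff]
    by_cases hs : s = 0
    · left; simp [hs]
    · right; simp [hs, hw.ne']
  have hd : ∀ s : ℝ, DifferentiableAt ℝ (fun s : ℝ => Complex.log (1 - (s:ℂ) * w)) s := by
    intro s
    have h2 : HasDerivAt (fun s : ℝ => (s:ℂ)) 1 s := Complex.ofRealCLM.hasDerivAt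
    exact (((h2.mul_const w).const_sub 1).clog_real (hslit s)).differentiableAt
  have hc : ContinuousOn (dslope (fun s : ℝ => Complex.log (1 - (s:ℂ) * w)) 0) Set.univ := by
    rw [continuousOn_dslope Filter.univ_mem]
    exact ⟨fun s _ => (hd s).continuousAt.continuousWithinAt, hd 0⟩
  have hi : IntervalIntegrable (dslope (fun s : ℝ => Complex.log (1 - (s:ℂ) * w)) 0) volume 0 1 :=
    (hc.mono (Set.subset_univ _)).intervalIntegrable
  refine hi.congr ?_
  intro s hs
  rw [Set.uIoc_of_le zero_le_one] at hs
  have h0 : s ≠ 0 := hs.1.ne'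
  simp only [dslope_of_ne _ h0, slope_def_module]
  simp [div_eq_inv_mul]

theorem Li2_small (w : ℂ) (hw : ‖w‖ ≤ 1/2) : ‖Li2 w‖ ≤ 1 := by
  unfold Li2
  rw [norm_neg]
  have := intervalIntegral.norm_integral_le_of_norm_le_const (a := (0:ℝ)) (b := 1) (C := 1)
    (f := fun s : ℝ => Complex.log (1 - (s:ℂ) * w) / (s:ℂ)) ?_
  · simpa using this
  intro s hs
  rw [Set.uIoc_of_le zero_le_one] at hs
  have hs0 := hs.1
  have hs1 := hs.2
  have hn : ‖-((s:ℂ) * w)‖ = s * ‖w‖ := by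
    rw [norm_neg, norm_mul, Complex.norm_real, Real.norm_of_nonneg hs0.le]
  have h2 : ‖-((s:ℂ) * w)‖ ≤ 1/2 := by
    rw [hn]; nlinarith [norm_nonneg w]
  have h3 := Complex.norm_log_one_add_half_le_self h2
  rw [norm_div, Complex.norm_real, Real.norm_of_nonneg hs0.le, div_le_iff₀ hs0, sub_eq_add_neg]
  refine h3.trans ?_
  rw [hn]; nlinarith [norm_nonneg w]

theorem arg_bound_s12 (θ Y : ℝ) (h0 : 0 < θ) (h1 : θ < Real.pi) (hY : 2 ≤ Real.exp Y) :
    θ - 3 / 2 * Real.exp (-Y) ≤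
      -(Complex.log (1 + Complex.exp ((Y:ℂ) - θ * Complex.I))).im := by
  set u : ℂ := Complex.exp (-((Y:ℂ) - θ * Complex.I)) with hu
  have hun : ‖u‖ = Real.exp (-Y) := by
    rw [hu, Complex.norm_exp]; simp
  have hul : ‖u‖ ≤ 1/2 := by
    rw [hun, Real.exp_neg, one_div]
    exact inv_anti₀ (by norm_num) hY
  have huim : 0 < u.im := by
    rw [hu, Complex.exp_im]
    have := Real.sin_pos_of_pos_of_lt_pi h0 h1
    simp
    positivity
  have hl := Complex.norm_log_one_add_half_le_self hul
  have him := (Complex.abs_im_le_norm (Complex.log (1+u))).trans hl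
  rw [Complex.log_im, abs_le] at him
  have hargexp : (Complex.exp ((Y:ℂ) - θ * Complex.I)).arg = -θ := by
    have : (Complex.log (Complex.exp ((Y:ℂ) - θ * Complex.I))) = (Y:ℂ) - θ * Complex.I :=
      Complex.log_exp (by simp; linarith) (by simp; linarith)
    rw [← Complex.log_im, this]; simp
  have harg0 : 0 ≤ (1+u).arg := by
    rw [Complex.arg_nonneg_iff]; simp; exact huim.le
  have hu1 : (1 + u) ≠ 0 := by
    intro h
    have := congrArg Complex.im h
    simp at this
    linarith
  have hpi := Real.pi_gt_three
  have hsum : (Complex.exp ((Y:ℂ) - θ * Complex.I)).arg + (1+u).arg ∈ Set.Ioc (-Real.pi) Real.pi := by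
    rw [hargexp]; constructor <;> linarith
  have hm := Complex.arg_mul (Complex.exp_ne_zero _) hu1 hsum
  have hprod : Complex.exp ((Y:ℂ) - θ * Complex.I) * (1+u) = 1 + Complex.exp ((Y:ℂ) - θ * Complex.I) := by
    rw [mul_add, hu, ← Complex.exp_add]; simp [add_comm]
  rw [Complex.log_im, ← hprod, hm, hargexp, ← hun]
  linarith

theorem Li2_large (θ X : ℝ) (h0 : 0 < θ) (h1 : θ < Real.pi) (hX : 2 ≤ Real.exp X) :
    θ * X - 4 ≤ (Li2 (-Complex.exp ((X:ℂ) - θ * Complex.I))).im := by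
  set p : ℂ := Complex.exp ((X:ℂ) - θ * Complex.I) with hp
  have hsin := Real.sin_pos_of_pos_of_lt_pi h0 h1
  have hpim : p.im < 0 := by
    rw [hp, Complex.exp_im]; simp; positivity
  have hwim : 0 < (-p).im := by simpa using hpim
  have hint := Li2_integrable (-p) hwim
  have hre : IntervalIntegrable (fun s : ℝ => (Complex.log (1 - (s:ℂ) * (-p)) / (s:ℂ)).im) volume 0 1 := by
    rw [intervalIntegrable_iff] at hint ⊢
    exact hint.im
  have heq : (Li2 (-p)).im = ∫ s in (0:ℝ)..1, -(Complex.log (1 - (s:ℂ) * (-p)) / (s:ℂ)).im := by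
    unfold Li2
    rw [Complex.neg_im, intervalIntegral.integral_neg]
    congr 1
    have := Complex.imCLM.intervalIntegral_comp_comm hint
    simpa using this.symm
  set ρ := Real.exp X with hρ
  have hρ0 : 0 < ρ := Real.exp_pos _
  have ha0 : 0 < 2/ρ := by positivity
  have ha1 : 2/ρ ≤ 1 := by rw [div_le_one hρ0]; exact hX
  have hform : ∀ s : ℝ, (Complex.log (1 - (s:ℂ) * (-p)) / (s:ℂ)).im = (Complex.log (1 + (s:ℂ) * p)).im / s := by
    intro s
    rw [Complex.div_ofReal_im]
    simp
  simp only [hform] at heq hre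
  have hA : IntervalIntegrable (fun s : ℝ => -((Complex.log (1 + (s:ℂ) * p)).im / s)) volume 0 (2/ρ) :=
    hre.neg.mono_set (by
      rw [Set.uIcc_of_le ha0.le, Set.uIcc_of_le zero_le_one]
      exact Set.Icc_subset_Icc le_rfl ha1)
  have hB : IntervalIntegrable (fun s : ℝ => -((Complex.log (1 + (s:ℂ) * p)).im / s)) volume (2/ρ) 1 :=
    hre.neg.mono_set (by
      rw [Set.uIcc_of_le ha1, Set.uIcc_of_le zero_le_one]
      exact Set.Icc_subset_Icc ha0.le le_rfl)
  rw [heq, ← intervalIntegral.integral_add_adjacent_intervals hA hB]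
  have hI1 : 0 ≤ ∫ s in (0:ℝ)..(2/ρ), -((Complex.log (1 + (s:ℂ) * p)).im / s) := by
    apply intervalIntegral.integral_nonneg ha0.le
    intro s hs
    rw [← neg_div]
    apply div_nonneg _ hs.1
    rw [Complex.log_im]
    rcases hs.1.eq_or_lt with h | h
    · rw [← h]; simp
    · have : (1 + (s:ℂ) * p).arg < 0 := by
        rw [Complex.arg_neg_iff]; simp; nlinarith
      linarith
  have hder : ∀ s ∈ Set.uIcc (2/ρ) 1, HasDerivAt (fun s : ℝ => θ * Real.log s + 3/(2*ρ) * s⁻¹)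
      (θ * s⁻¹ + 3/(2*ρ) * (-(s^2)⁻¹)) s := by
    intro s hs
    rw [Set.uIcc_of_le ha1] at hs
    have hs0 : s ≠ 0 := (ha0.trans_le hs.1).ne'
    exact ((Real.hasDerivAt_log hs0).const_mul θ).add ((hasDerivAt_inv hs0).const_mul _)
  have hci : IntervalIntegrable (fun s : ℝ => θ * s⁻¹ + 3/(2*ρ) * (-(s^2)⁻¹)) volume (2/ρ) 1 := by
    apply ContinuousOn.intervalIntegrable
    intro s hs
    rw [Set.uIcc_of_le ha1] at hs
    have hs0 : s ≠ 0 := (ha0.trans_le hs.1).ne'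
    apply ContinuousAt.continuousWithinAt
    fun_prop (disch := simp [hs0])
  have hFTC := intervalIntegral.integral_eq_sub_of_hasDerivAt hder hci
  have hI2 : ∫ s in (2/ρ)..1, (θ * s⁻¹ + 3/(2*ρ) * (-(s^2)⁻¹)) ≤
      ∫ s in (2/ρ)..1, -((Complex.log (1 + (s:ℂ) * p)).im / s) := by
    apply intervalIntegral.integral_mono_on ha1 hci hB
    intro s hs
    have hs0 : 0 < s := ha0.trans_le hs.1
    have hsρ : Real.exp (Real.log s + X) = s * ρ := by
      rw [Real.exp_add, Real.exp_log hs0]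
    have h2 : 2 ≤ s * ρ := by
      have := hs.1; rwa [div_le_iff₀ hρ0] at this
    have := arg_bound_s12 θ (Real.log s + X) h0 h1 (by rw [hsρ]; exact h2)
    have he : Complex.exp (((Real.log s + X : ℝ) : ℂ) - θ * Complex.I) = s * p := by
      rw [hp, Complex.ofReal_add, add_sub_assoc, Complex.exp_add, ← Complex.ofReal_exp, Real.exp_log hs0]
    rw [he, Real.exp_neg, hsρ] at this
    rw [← neg_div, le_div_iff₀ hs0]
    refine le_trans (le_of_eq ?_) this
    field_simp
    ring
  rw [hFTC] at hI2
  have hlog : Real.log (2/ρ) = Real.log 2 - X := by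
    rw [Real.log_div (by norm_num) hρ0.ne', hρ, Real.log_exp]
  rw [hlog, Real.log_one, inv_div] at hI2
  have e1 : 3/(2*ρ) * (ρ/2) = 3/4 := by field_simp; norm_num
  rw [e1] at hI2
  have hl2 := Real.log_two_lt_d9
  have hl2' := Real.log_two_gt_d9
  have hpi := Real.pi_lt_d2
  have : 0 < 3/(2*ρ) := by positivity
  nlinarith

theorem fQt_re (σ μ : ℝ) (t : ℂ) : (fQt σ μ t).re =
    -((Li2 (-Complex.exp (2*(Real.pi:ℂ)*(μ:ℂ)))).im
      + (Li2 (-Complex.exp (2*(Real.pi:ℂ)*(t-(σ:ℂ))))).im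
      + (Li2 (-Complex.exp (2*(Real.pi:ℂ)*(t+(σ:ℂ))))).im) / (2*Real.pi)
    - 2*Real.pi*μ*t.im + Real.pi*(t.re-μ) := by
  unfold fQt
  generalize Li2 (-Complex.exp (2*(Real.pi:ℂ)*(μ:ℂ))) = A
  generalize Li2 (-Complex.exp (2*(Real.pi:ℂ)*(t-(σ:ℂ)))) = B
  generalize Li2 (-Complex.exp (2*(Real.pi:ℂ)*(t+(σ:ℂ)))) = D
  have h : -(A + B + D) / (2*(Real.pi:ℂ)*Complex.I) = (A+B+D) * Complex.I / ((2*Real.pi:ℝ):ℂ) := by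
    have : (Real.pi:ℂ) ≠ 0 := by exact_mod_cast Real.pi_ne_zero
    push_cast
    field_simp
    rw [Complex.I_sq]; ring
  rw [h]
  simp only [Complex.add_re, Complex.div_ofReal_re]
  simp
  ring

theorem fQt_bound (σ μ δ : ℝ) (hδ : δ ∈ Set.Ioo (0:ℝ) (1/8)) :
    ∃ K > (0:ℝ), ∀ t : ℂ, |σ| + 1 ≤ |t.re| → t.im ∈ Set.Ioo (-(1:ℝ)/2) (-1/4 - δ) →
      (fQt σ μ t).re ≤ K - 4 * Real.pi * δ * |t.re| := by
  obtain ⟨hd0, hd1⟩ := hδ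
  have hpi := Real.pi_gt_three
  have hpi' := Real.pi_pos
  set A := Li2 (-Complex.exp (2*(Real.pi:ℂ)*(μ:ℂ))) with hA
  refine ⟨‖A‖ + 10 + 2*Real.pi*|μ|, by positivity, ?_⟩
  intro t ht ⟨hy0, hy1⟩
  rw [fQt_re, ← hA]
  have hAim := abs_le.mp (Complex.abs_im_le_norm A)
  have hμ := abs_le.mp (le_refl |μ|)
  have hσ := abs_le.mp (le_refl |σ|)
  have hμ0 := abs_nonneg μ
  have hterm : -2*Real.pi*μ*t.im - Real.pi * μ ≤ 2*Real.pi*|μ| := by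
    have : -2*μ*t.im - μ ≤ 2*|μ| := by nlinarith
    nlinarith
  have h2pi : 0 < 2 * Real.pi := by positivity
  have hdiv : ∀ M N : ℝ, -(M) ≤ N * (2*Real.pi) → -(M)/(2*Real.pi) ≤ N := by
    intro M N h; rwa [div_le_iff₀ h2pi]
  have hnA := norm_nonneg A
  rcases le_total 0 t.re with hx | hx
  · rw [abs_of_nonneg hx] at ht ⊢
    have key : ∀ τ : ℝ, 1 ≤ t.re + τ → (-2*Real.pi*t.im) * (2*Real.pi*(t.re+τ)) - 4 ≤
        (Li2 (-Complex.exp (2*(Real.pi:ℂ)*(t+(τ:ℂ))))).im := by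
      intro τ hτ
      have h := Li2_large (-2*Real.pi*t.im) (2*Real.pi*(t.re+τ)) (by nlinarith) (by nlinarith) (by
        have := Real.add_one_le_exp (2*Real.pi*(t.re+τ))
        nlinarith)
      have e : ((2*Real.pi*(t.re+τ) : ℝ) : ℂ) - ((-2*Real.pi*t.im : ℝ):ℂ) * Complex.I
          = 2*(Real.pi:ℂ)*(t+(τ:ℂ)) := by
        apply Complex.ext <;> simp
      rwa [e] at h
    have k1 := key σ (by linarith)
    have k2 := key (-σ) (by linarith)
    rw [Complex.ofReal_neg, ← sub_eq_add_neg] at k2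
    generalize (Li2 (-Complex.exp (2*(Real.pi:ℂ)*(t-(σ:ℂ))))).im = B at *
    generalize (Li2 (-Complex.exp (2*(Real.pi:ℂ)*(t+(σ:ℂ))))).im = D at *
    have := hdiv (A.im + B + D) (‖A‖ + 8 + 4*Real.pi*t.re*t.im) (by nlinarith)
    have h4 : 4*Real.pi*t.re*t.im + Real.pi * t.re ≤ - 4 * Real.pi * δ * t.re := by
      have : 0 ≤ Real.pi * t.re * (-1 - 4*δ - 4*t.im) :=
        mul_nonneg (by positivity) (by linarith)
      nlinarith
    nlinarith
  · rw [abs_of_nonpos hx] at ht ⊢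
    have key : ∀ τ : ℝ, t.re + τ ≤ -1 →
        ‖Li2 (-Complex.exp (2*(Real.pi:ℂ)*(t+(τ:ℂ))))‖ ≤ 1 := by
      intro τ hτ
      apply Li2_small
      rw [norm_neg, Complex.norm_exp]
      have e : (2*(Real.pi:ℂ)*(t+(τ:ℂ))).re = -(-(2*Real.pi*(t.re+τ))) := by simp
      rw [e, Real.exp_neg, one_div]
      apply inv_anti₀ (by norm_num)
      have := Real.add_one_le_exp (-(2*Real.pi*(t.re+τ)))
      nlinarith
    have k1 := abs_le.mp ((Complex.abs_im_le_norm _).trans (key σ (by linarith)))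
    have k2 := key (-σ) (by linarith)
    rw [Complex.ofReal_neg, ← sub_eq_add_neg] at k2
    replace k2 := abs_le.mp ((Complex.abs_im_le_norm _).trans k2)
    generalize (Li2 (-Complex.exp (2*(Real.pi:ℂ)*(t-(σ:ℂ))))).im = B at *
    generalize (Li2 (-Complex.exp (2*(Real.pi:ℂ)*(t+(σ:ℂ))))).im = D at *
    have := hdiv (A.im + B + D) (‖A‖ + 8) (by nlinarith)
    have h4 : Real.pi * t.re ≤ 4 * Real.pi * δ * t.re := by
      have : 0 ≤ Real.pi * (-t.re) * (1 - 4*δ) :=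
        mul_nonneg (mul_nonneg hpi'.le (by linarith)) (by linarith)
      nlinarith
    nlinarith

/-- exponential decay of the integrand `e^{f(t)/b²} g(t)` for `𝓠`. -/
theorem Q_integrand_decay (σ μ : ℝ) (δ : ℝ) (hδ : δ ∈ Set.Ioo (0:ℝ) (1/8)) :
    ∃ C > (0:ℝ), ∃ c > (0:ℝ), ∃ T > (0:ℝ), ∃ b₀ ∈ Set.Ioo (0:ℝ) 1, ∀ t : ℂ,
      T ≤ |t.re| → t.im ∈ Set.Ioo (-(1:ℝ)/2) (-1/4 - δ) → ∀ b ∈ Set.Ioo (0:ℝ) b₀,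
      ‖Complex.exp (fQt σ μ t / (b:ℂ)^2) * gQ μ t‖ ≤ C * Real.exp (-(c * |t.re| / b^2)) := by
  obtain ⟨K, hK, hf⟩ := fQt_bound σ μ δ hδ
  obtain ⟨hd0, hd1⟩ := hδ
  have hpi := Real.pi_pos
  refine ⟨Real.exp (-(Real.pi*μ)), Real.exp_pos _, Real.pi*δ, by positivity,
    |σ| + 1 + K/(Real.pi*δ), by positivity, δ, ⟨hd0, by linarith⟩, ?_⟩
  intro t ht hy b ⟨hb0, hb1⟩
  have hKd : 0 < K/(Real.pi*δ) := by positivity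
  have h1 := hf t (by linarith) hy
  have h2 : K ≤ Real.pi*δ*|t.re| := by
    have : K/(Real.pi*δ) ≤ |t.re| := by linarith [abs_nonneg σ]
    rw [div_le_iff₀ (by positivity)] at this
    linarith
  have hb2 : 0 < b^2 := by positivity
  have hg : ‖gQ μ t‖ = Real.exp (Real.pi*(t.re-μ)) := by
    unfold gQ; rw [Complex.norm_exp]; simp
  have hff : ‖Complex.exp (fQt σ μ t / (b:ℂ)^2)‖ = Real.exp ((fQt σ μ t).re / b^2) := by
    rw [Complex.norm_exp, ← Complex.ofReal_pow, Complex.div_ofReal_re]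
  rw [norm_mul, hg, hff, ← Real.exp_add, ← Real.exp_add, Real.exp_le_exp]
  have h3 : (fQt σ μ t).re / b^2 ≤ -(3*(Real.pi*δ*|t.re|)) / b^2 := by
    apply div_le_div_of_nonneg_right _ hb2.le
    linarith
  have h4 : Real.pi * t.re ≤ 2*(Real.pi*δ*|t.re|) / b^2 := by
    rw [le_div_iff₀ hb2]
    have hx := le_abs_self t.re
    have hx0 := abs_nonneg t.re
    have hbd : b^2 ≤ 2*δ := by nlinarith
    calc Real.pi * t.re * b^2 ≤ Real.pi * |t.re| * b^2 := by gcongr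
      _ ≤ Real.pi * |t.re| * (2*δ) := by gcongr
      _ = _ := by ring
  have e : -(3*(Real.pi*δ*|t.re|)) / b^2 + 2*(Real.pi*δ*|t.re|) / b^2 = -(Real.pi*δ*|t.re|/b^2) := by ring
  linarith
end
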